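/- Pieri rule for Hall–Littlewood polynomials with a complete homogeneous symmetric function (Konvalinka–Lauve, Theorem 1): for every partition μ and integer r ≥ 0, P_μ(X;t)·h_r(X) = Σ_λ sk_{λ/μ}(t) P_λ(X;t), where the sum is over all partitions λ with |λ| = |μ| + r. -/

import Mathlib

/-!
Common framework: integer partitions, Gaussian binomials, Hall--Littlewood
Pieri coefficients, the ring of symmetric functions realized as polynomials
in the power sums, the Macdonald `(q,t)`-inner product, a characterisation
of the Macdonald polynomials `P_λ(X;q,t)`, skew Macdonald polynomials,
plethystic evaluations and the various Pieri coefficients of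
Konvalinka--Lauve and Warnaar.
-/

open scoped BigOperators

noncomputable section

namespace SkewPieriFormalization

/-- An integer partition, encoded as a finitely supported weakly decreasing
sequence of natural numbers; `part j` is the part `λ_{j+1}` (0-indexed). -/
structure Partition where
  part : ℕ →₀ ℕ
  antitone' : ∀ ⦃i j : ℕ⦄, i ≤ j → part j ≤ part i

namespace Partition

/-- Containment of Young diagrams: `μ ≤ λ` iff `μ_i ≤ λ_i` for all `i`. -/
instance : LE Partition := ⟨fun mu lam => ∀ j : ℕ, mu.part j ≤ lam.part j⟩

/-- `|λ|`, the size (sum of the parts). -/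
def size (lam : Partition) : ℕ := lam.part.sum fun _ k => k

/-- `l(λ)`, the number of (nonzero) parts. -/
def length (lam : Partition) : ℕ := lam.part.support.card

/-- `n(λ) = ∑_{i ≥ 1} (i-1) λ_i`. -/
def nstat (lam : Partition) : ℕ := lam.part.sum fun j k => j * k

/-- the `i`-th part `λ_i` (1-indexed). -/
def row (lam : Partition) (i : ℕ) : ℕ := lam.part (i - 1)

/-- the part `λ'_i = #{j : λ_j ≥ i}` of the conjugate partition (for `i ≥ 1`). -/
def conj (lam : Partition) (i : ℕ) : ℕ :=
  (lam.part.support.filter fun j => i ≤ lam.part j).card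

/-- the multiplicity `m_r(λ)` of `r` as a part of `λ`. -/
def mult (lam : Partition) (r : ℕ) : ℕ :=
  (lam.part.support.filter fun j => lam.part j = r).card

/-- `z_λ = ∏_{r ≥ 1} r^{m_r} m_r!`. -/
def zee (lam : Partition) : ℕ :=
  ∏ r ∈ Finset.Icc 1 (lam.part 0), r ^ lam.mult r * Nat.factorial (lam.mult r)

/-- the partial sum `λ_1 + ⋯ + λ_k`. -/
def psum (lam : Partition) (k : ℕ) : ℕ := ∑ j ∈ Finset.range k, lam.part j

/-- dominance order: `λ ⊵ μ` (for `|λ| = |μ|`). -/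
def Dominates (lam mu : Partition) : Prop :=
  mu.size = lam.size ∧ ∀ k : ℕ, mu.psum k ≤ lam.psum k

/-- the one-row partition `(r)`. -/
def single (r : ℕ) : Partition where
  part := Finsupp.single 0 r
  antitone' := by
    intro i j hij
    by_cases hj : j = 0
    · have : i = 0 := by omega
      simp [hj, this]
    · simp only [Finsupp.single_apply]
      split <;> split <;> omega

/-- the one-column partition `(1^m)`. -/
def column (m : ℕ) : Partition where
  part := Finsupp.onFinset (Finset.range m) (fun j => if j < m then 1 else 0)
    (fun j h => by
      simp only [Finset.mem_range]
      by_contra hc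
      simp [hc] at h)
  antitone' := by
    intro i j hij
    simp only [Finsupp.onFinset_apply]
    split <;> split <;> omega

end Partition

variable {F : Type*} [Field F]

/-- the `t`-integer `[n]_t = 1 + t + ⋯ + t^{n-1}`. -/
def qint (t : F) (n : ℕ) : F := ∑ j ∈ Finset.range n, t ^ j

/-- the `t`-factorial. -/
def qfac (t : F) (n : ℕ) : F := ∏ j ∈ Finset.range n, qint t (j + 1)

/-- the Gaussian binomial coefficient `[n choose k]_t`; it vanishes
unless `0 ≤ k ≤ n`. -/
def qbinom (t : F) (n k : ℤ) : F :=
  if 0 ≤ k ∧ k ≤ n then qfac t n.toNat / (qfac t k.toNat * qfac t (n - k).toNat) else 0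

/-- the Hall--Littlewood Pieri coefficient
`ψ'_{λ/μ}(t) = ∏_{i ≥ 1} [λ'_i - λ'_{i+1} choose λ'_i - μ'_i]_t`;
it vanishes unless `μ ⊆ λ` with `λ - μ` a vertical strip. -/
def vsHL (t : F) (lam mu : Partition) : F :=
  ∏ i ∈ Finset.Icc 1 (lam.part 0 + mu.part 0),
    qbinom t ((lam.conj i : ℤ) - lam.conj (i + 1)) ((lam.conj i : ℤ) - mu.conj i)

open Classical in
/-- the Hall--Littlewood Pieri coefficient `φ_{λ/μ}(t)`, equal to
`∏ (1 - t^{λ'_i - λ'_{i+1}})` over those `i ≥ 1` with `λ'_i = μ'_i + 1` and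
`λ'_{i+1} = μ'_{i+1}`, when `μ ⊆ λ` with `λ - μ` a horizontal strip, and
vanishing otherwise. -/
def hsHL (t : F) (lam mu : Partition) : F :=
  if ∀ i : ℕ, mu.conj i ≤ lam.conj i ∧ lam.conj i ≤ mu.conj i + 1 then
    ∏ i ∈ Finset.Icc 1 (lam.part 0 + mu.part 0),
      if lam.conj i = mu.conj i + 1 ∧ lam.conj (i + 1) = mu.conj (i + 1) then
        1 - t ^ (lam.conj i - lam.conj (i + 1))
      else 1
  else 0

/-- `n(λ/μ) = ∑_{i ≥ 1} C(λ'_i - μ'_i, 2)`. -/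
def nskew (lam mu : Partition) : ℕ :=
  ∑ i ∈ Finset.Icc 1 (lam.part 0 + mu.part 0), Nat.choose (lam.conj i - mu.conj i) 2

/-- the Konvalinka--Lauve coefficient
`sk_{λ/μ}(t) = t^{n(λ/μ)} ∏_{i ≥ 1} [λ'_i - μ'_{i+1} choose λ'_i - μ'_i]_t`;
it vanishes unless `μ ⊆ λ`. -/
def skHL (t : F) (lam mu : Partition) : F :=
  t ^ nskew lam mu *
    ∏ i ∈ Finset.Icc 1 (lam.part 0 + mu.part 0),
      qbinom t ((lam.conj i : ℤ) - mu.conj (i + 1)) ((lam.conj i : ℤ) - mu.conj i)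

/-- The ring of symmetric functions over `F`, realized as the polynomial ring
in the power sums: the variable `n` is the power sum `p_{n+1}`. -/
abbrev Sym (F : Type*) [Field F] := MvPolynomial ℕ F

/-- the power sum product `p_λ = p_{λ_1} p_{λ_2} ⋯`. -/
def pprod (lam : Partition) : Sym F :=
  ∏ j ∈ lam.part.support, MvPolynomial.X (lam.part j - 1)

/-- Macdonald's `(q,t)`-deformation of the Hall inner product, for which the
power sums are orthogonal with `⟨p_λ, p_λ⟩ = z_λ ∏_i (1-q^{λ_i})/(1-t^{λ_i})`. -/
def innerQT (q t : F) (f g : Sym F) : F :=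
  ∑ d ∈ f.support,
    f.coeff d * g.coeff d *
      d.prod fun n m =>
        (((n : F) + 1) ^ m * (Nat.factorial m : F)) *
          ((1 - q ^ (n + 1)) / (1 - t ^ (n + 1))) ^ m

/-- the complete homogeneous symmetric function `h_r = ∑_{|κ| = r} z_κ⁻¹ p_κ`. -/
def hsym (F : Type*) [Field F] (r : ℕ) : Sym F :=
  ∑ᶠ (k : Partition) (_ : k.size = r), ((k.zee : F))⁻¹ • (pprod k : Sym F)

/-- the elementary symmetric function `e_r = ∑_{|κ| = r} (-1)^{r - l(κ)} z_κ⁻¹ p_κ`. -/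
def esym (F : Type*) [Field F] (r : ℕ) : Sym F :=
  ∑ᶠ (k : Partition) (_ : k.size = r),
    ((-1 : F) ^ (r - k.length) * (k.zee : F)⁻¹) • (pprod k : Sym F)

/-- `h_μ = h_{μ_1} h_{μ_2} ⋯`. -/
def hprod (F : Type*) [Field F] (mu : Partition) : Sym F :=
  ∏ j ∈ mu.part.support, hsym F (mu.part j)

/-- Characterisation of the (monic) Macdonald polynomial family
`λ ↦ P_λ(X;q,t)`: the `P_λ` are pairwise orthogonal for the `(q,t)`-inner
product, and `P_λ = m_λ + ∑_{μ ⊲ λ} u_{λμ} m_μ` is unitriangular with respect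
to dominance order in the monomial basis.  Since `{h_μ}` is the dual basis of
`{m_μ}` for the classical Hall pairing (the case `q = t`), unitriangularity is
expressed by the last two conditions.  For `q = 0` this characterises the
Hall--Littlewood polynomials `P_λ(X;t)`. -/
def IsMacdonald (q t : F) (P : Partition → Sym F) : Prop :=
  (∀ lam mu, lam ≠ mu → innerQT q t (P lam) (P mu) = 0) ∧
  (∀ lam, innerQT t t (P lam) (hprod F lam) = 1) ∧
  (∀ lam mu, ¬ Partition.Dominates lam mu → innerQT t t (P lam) (hprod F mu) = 0)

/-- `b_λ = ⟨P_λ, P_λ⟩⁻¹`. -/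
def bnorm (q t : F) (P : Partition → Sym F) (lam : Partition) : F :=
  (innerQT q t (P lam) (P lam))⁻¹

/-- `Q_λ = b_λ P_λ`. -/
def macQ (q t : F) (P : Partition → Sym F) (lam : Partition) : Sym F :=
  bnorm q t P lam • P lam

/-- the skew Macdonald polynomial `Q_{λ/μ}`, defined by
`⟨Q_{λ/μ}, P_ν⟩ = ⟨Q_λ, P_μ P_ν⟩`. -/
def skewQ (q t : F) (P : Partition → Sym F) (lam mu : Partition) : Sym F :=
  ∑ᶠ nu : Partition, innerQT q t (macQ q t P lam) (P mu * P nu) • macQ q t P nu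

/-- the skew Macdonald polynomial `P_{λ/μ}`, defined by
`⟨P_{λ/μ}, Q_ν⟩ = ⟨P_λ, Q_μ Q_ν⟩`. -/
def skewP (q t : F) (P : Partition → Sym F) (lam mu : Partition) : Sym F :=
  ∑ᶠ nu : Partition, innerQT q t (P lam) (macQ q t P mu * macQ q t P nu) • P nu

/-- the Littlewood--Richardson coefficient `f_{μν}^λ(q,t) = ⟨Q_λ, P_μ P_ν⟩`,
so that `P_μ P_ν = ∑_λ f_{μν}^λ P_λ`. -/
def lr (q t : F) (P : Partition → Sym F) (mu nu lam : Partition) : F :=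
  innerQT q t (macQ q t P lam) (P mu * P nu)

/-- the plethystic evaluation `f ↦ f((a-b)/(1-t))`, determined on power sums
by `p_r ↦ (a^r - b^r)/(1 - t^r)`. -/
def plethAB (t a b : F) (f : Sym F) : F :=
  MvPolynomial.eval (fun n => (a ^ (n + 1) - b ^ (n + 1)) / (1 - t ^ (n + 1))) f

/-- `vs_{λ/μ}(q,t) = ψ'_{λ/μ}(q,t) = (-1)^{|λ|-|μ|} Q_{λ/μ}((q-1)/(1-t))`. -/
def vsM (q t : F) (P : Partition → Sym F) (lam mu : Partition) : F :=
  (-1 : F) ^ ((lam.size : ℤ) - (mu.size : ℤ)) * plethAB t q 1 (skewQ q t P lam mu)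

/-- `sk_{λ/μ}(q,t) = Q_{λ/μ}((1-q)/(1-t))`. -/
def skM (q t : F) (P : Partition → Sym F) (lam mu : Partition) : F :=
  plethAB t 1 q (skewQ q t P lam mu)

/-- `ŝk_{λ/μ}(q,t) = Q_{λ/μ}((1-q/t)/(1-t))`. -/
def skHatM (q t : F) (P : Partition → Sym F) (lam mu : Partition) : F :=
  plethAB t 1 (q / t) (skewQ q t P lam mu)

/-- `hs_{λ/μ}(q,t) = φ_{λ/μ}(q,t) = Q_{λ/μ}(1)`, the plethystic evaluation
`p_r ↦ 1`. -/
def hsM (q t : F) (P : Partition → Sym F) (lam mu : Partition) : F :=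
  MvPolynomial.eval (fun _ => (1 : F)) (skewQ q t P lam mu)

/-- `ks_{λ/μ}(q,t) = Q_{λ/μ}(-1)`, the plethystic evaluation `p_r ↦ -1`. -/
def ksM (q t : F) (P : Partition → Sym F) (lam mu : Partition) : F :=
  MvPolynomial.eval (fun _ => (-1 : F)) (skewQ q t P lam mu)

/-- the finite `q`-Pochhammer symbol `(a;q)_k = ∏_{j=0}^{k-1}(1 - a q^j)`. -/
def qPochN (qq a : F) (k : ℕ) : F := ∏ j ∈ Finset.range k, (1 - a * qq ^ j)

/-- the `q`-Pochhammer symbol `(a;q)_k = (a;q)_∞/(a q^k;q)_∞` for `k ∈ ℤ`;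
for `k = -m < 0` it equals `1/∏_{i=1}^m (1 - a q^{-i})`. -/
def qPochZ (qq a : F) (k : ℤ) : F :=
  if 0 ≤ k then qPochN qq a k.toNat
  else (∏ j ∈ Finset.range (-k).toNat, (1 - a * (qq⁻¹) ^ (j + 1)))⁻¹

/-- `(a)_λ = (a;q,t)_λ = ∏_{i ≥ 1} (a t^{1-i}; q)_{λ_i}`. -/
def qtPoch (qq tt a : F) (lam : Partition) : F :=
  ∏ j ∈ lam.part.support, qPochN qq (a * tt ^ (-(j : ℤ))) (lam.part j)

/-- the degree (as a symmetric function) of a power-sum exponent vector. -/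
def wt (d : ℕ →₀ ℕ) : ℕ := d.sum fun n m => (n + 1) * m

/-- the degree-`r` homogeneous component of `∏_x (bx;q)_∞/(ax;q)_∞`, namely
`∑_{|κ| = r} z_κ⁻¹ ∏_i (a^{κ_i} - b^{κ_i})/(1 - q^{κ_i}) · p_κ`. -/
def prodComp (a b qq : F) (r : ℕ) : Sym F :=
  ∑ᶠ (k : Partition) (_ : k.size = r),
    ((k.zee : F)⁻¹ *
        ∏ j ∈ k.part.support,
          (a ^ k.part j - b ^ k.part j) / (1 - qq ^ k.part j)) • (pprod k : Sym F)

/-- `∏_x (bx;q)_∞/(ax;q)_∞`, where `(cx;q)_∞ = ∏_{j ≥ 0}(1 - cx q^j)`, as a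
formal power series in the power sums. -/
def prodSeries (a b qq : F) : MvPowerSeries ℕ F :=
  fun d => MvPolynomial.coeff d (prodComp a b qq (wt d))

/-- the formal (possibly infinite) sum `∑_i c_i g_i` of symmetric functions,
as a formal power series in the power sums. -/
def sumSeries {ι : Type*} (c : ι → F) (g : ι → Sym F) : MvPowerSeries ℕ F :=
  fun d => ∑ᶠ i : ι, c i * MvPolynomial.coeff d (g i)

/-- `ℚ(t)` -/
abbrev F1 : Type := RatFunc ℚ
/-- `ℚ(t)(q)` -/
abbrev F2 : Type := RatFunc F1
/-- `ℚ(t)(q)(a)` -/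
abbrev F3 : Type := RatFunc F2
/-- `ℚ(t)(q)(a)(b)` -/
abbrev F4 : Type := RatFunc F3

instance : Field F2 := inferInstance
instance : Field F3 := inferInstance
instance : Field F4 := inferInstance

/-- the indeterminate `t` in `ℚ(t)`. -/
def t1 : F1 := RatFunc.X
/-- the indeterminate `q` in `ℚ(t)(q)`. -/
def q2 : F2 := RatFunc.X
/-- the indeterminate `t` in `ℚ(t)(q)`. -/
def t2 : F2 := RatFunc.C t1
/-- the indeterminate `a` in `ℚ(t)(q)(a)`. -/
def a3 : F3 := RatFunc.X
/-- the indeterminate `q` in `ℚ(t)(q)(a)`. -/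
def q3 : F3 := RatFunc.C q2
/-- the indeterminate `t` in `ℚ(t)(q)(a)`. -/
def t3 : F3 := RatFunc.C t2
/-- the indeterminate `b` in `ℚ(t)(q)(a)(b)`. -/
def b4 : F4 := RatFunc.X
/-- the indeterminate `a` in `ℚ(t)(q)(a)(b)`. -/
def a4 : F4 := RatFunc.C a3
/-- the indeterminate `q` in `ℚ(t)(q)(a)(b)`. -/
def q4 : F4 := RatFunc.C q3
/-- the indeterminate `t` in `ℚ(t)(q)(a)(b)`. -/
def t4 : F4 := RatFunc.C t3


set_option linter.all false

set_option linter.all false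
set_option linter.unusedSectionVars false
set_option linter.unusedSimpArgs false
set_option linter.unusedVariables false
set_option linter.unnecessarySeqFocus false

section HallGen

variable {K : Type*} [CommRing K] [IsDomain K] [CharZero K]

/-- Uniqueness of solutions of the first order linear differential equation. -/
theorem ode_unique (A f g : PowerSeries K)
    (hf : PowerSeries.derivative K f = A * f) (hg : PowerSeries.derivative K g = A * g)
    (h0 : PowerSeries.coeff 0 f = PowerSeries.coeff 0 g) : f = g := by
  ext n
  induction n using Nat.strong_induction_on with
  | _ n ih =>
    cases n with
    | zero => exact h0
    | succ n =>
      have h1 := congrArg (PowerSeries.coeff n) hf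
      have h2 := congrArg (PowerSeries.coeff n) hg
      rw [PowerSeries.coeff_derivative, PowerSeries.coeff_mul] at h1 h2
      have h3 : PowerSeries.coeff (n + 1) f * ((n : K) + 1)
          = PowerSeries.coeff (n + 1) g * ((n : K) + 1) := by
        rw [h1, h2]
        refine Finset.sum_congr rfl fun p hp => ?_
        rw [ih p.2 (by have := Finset.HasAntidiagonal.mem_antidiagonal.1 hp; omega)]
      exact mul_right_cancel₀ (by exact_mod_cast Nat.succ_ne_zero n) h3

end HallGen

section GenSeries

variable {F : Type*} [Field F]

/-- coefficients of `exp (∑ a_k p_{k+1} u^{k+1} / (k+1))`. -/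
def gco (a : ℕ → F) : ℕ → Sym F
  | 0 => 1
  | n + 1 => MvPolynomial.C ((n : F) + 1)⁻¹ *
      ∑ i : Fin (n + 1), MvPolynomial.C (a (n - i)) * MvPolynomial.X (n - i) * gco a i

/-- the generating series. -/
def gser (a : ℕ → F) : PowerSeries (Sym F) := PowerSeries.mk (gco a)

/-- the logarithmic derivative. -/
def aser (a : ℕ → F) : PowerSeries (Sym F) :=
  PowerSeries.mk fun k => MvPolynomial.C (a k) * MvPolynomial.X k

theorem gco_zero (a : ℕ → F) : gco a 0 = 1 := by rw [gco]

variable [CharZero F]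

theorem gco_rec (a : ℕ → F) (n : ℕ) :
    ((n : Sym F) + 1) * gco a (n + 1) = ∑ p ∈ Finset.HasAntidiagonal.antidiagonal n,
      MvPolynomial.C (a p.1) * MvPolynomial.X p.1 * gco a p.2 := by
  rw [gco, ← mul_assoc]
  have : ((n : Sym F) + 1) * MvPolynomial.C ((n : F) + 1)⁻¹ = 1 := by
    have h : ((n : Sym F) + 1) = MvPolynomial.C ((n : F) + 1) := by simp
    rw [h, ← map_mul, mul_inv_cancel₀ (by exact_mod_cast Nat.succ_ne_zero n), map_one]
  rw [this, one_mul, ← Finset.sum_range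
    (fun i => MvPolynomial.C (a (n - i)) * MvPolynomial.X (n - i) * gco a i)]
  rw [← Finset.Nat.sum_antidiagonal_eq_sum_range_succ
    (fun i j => MvPolynomial.C (a j) * MvPolynomial.X j * gco a i)]
  exact Finset.Nat.sum_antidiagonal_swap
    (f := fun p : ℕ × ℕ => MvPolynomial.C (a p.1) * MvPolynomial.X p.1 * gco a p.2)

theorem gser_deriv (a : ℕ → F) :
    PowerSeries.derivative (Sym F) (gser a) = aser a * gser a := by
  ext1 n
  rw [PowerSeries.coeff_derivative, PowerSeries.coeff_mul, mul_comm]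
  simp only [gser, aser, PowerSeries.coeff_mk]
  exact gco_rec a n

theorem gser_unique (a : ℕ → F) (g : ℕ → Sym F) (h0 : g 0 = 1)
    (h : ∀ n : ℕ, ((n : Sym F) + 1) * g (n + 1) = ∑ p ∈ Finset.HasAntidiagonal.antidiagonal n,
      MvPolynomial.C (a p.1) * MvPolynomial.X p.1 * g p.2) (n : ℕ) : g n = gco a n := by
  have : PowerSeries.mk g = gser a := by
    refine ode_unique (aser a) _ _ ?_ (gser_deriv a) (by simp [gser, h0, gco_zero])
    ext1 n
    rw [PowerSeries.coeff_derivative, PowerSeries.coeff_mul, mul_comm]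
    simp only [aser, PowerSeries.coeff_mk]
    exact h n
  have := congrArg (PowerSeries.coeff n) this
  simpa [gser] using this

theorem gser_mul (a b : ℕ → F) : gser a * gser b = gser (fun k => a k + b k) := by
  refine ode_unique (aser (fun k => a k + b k)) _ _ ?_ (gser_deriv _) ?_
  · have : aser (fun k => a k + b k) = aser a + aser b := by
      ext1 n; simp [aser, add_mul]
    rw [Derivation.leibniz, gser_deriv, gser_deriv, this]
    simp only [smul_eq_mul]; ring
  · simp [gser, gco_zero]

theorem gco_mul (a b : ℕ → F) (n : ℕ) :
    ∑ p ∈ Finset.HasAntidiagonal.antidiagonal n, gco a p.1 * gco b p.2 = gco (fun k => a k + b k) n := by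
  have := congrArg (PowerSeries.coeff n) (gser_mul a b)
  rw [PowerSeries.coeff_mul] at this
  simpa [gser] using this

theorem gco_scale (a : ℕ → F) (s : F) (n : ℕ) :
    MvPolynomial.C (s ^ n) * gco a n = gco (fun k => s ^ (k + 1) * a k) n := by
  refine gser_unique (fun k => s ^ (k + 1) * a k) (fun n => MvPolynomial.C (s ^ n) * gco a n)
    (by simp [gco_zero]) (fun n => ?_) n
  rw [mul_left_comm, gco_rec, Finset.mul_sum]
  refine Finset.sum_congr rfl fun p hp => ?_
  have := Finset.HasAntidiagonal.mem_antidiagonal.1 hp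
  rw [← this, show p.1 + p.2 + 1 = (p.1 + 1) + p.2 by ring, pow_add]
  simp only [map_mul]; ring

theorem gco_null (n : ℕ) : gco (fun _ => (0 : F)) n = if n = 0 then 1 else 0 := by
  symm
  refine gser_unique (fun _ => (0 : F)) (fun n => if n = 0 then 1 else 0) (by simp)
    (fun n => ?_) n
  simp

theorem gco_const (a : ℕ → F) (n : ℕ) (hn : n ≠ 0) :
    MvPolynomial.constantCoeff (gco a n) = 0 := by
  obtain ⟨n, rfl⟩ := Nat.exists_eq_succ_of_ne_zero hn
  rw [Nat.succ_eq_add_one, gco]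
  simp

/-- the shift homomorphism `p_{k+1} ↦ p_{k+1} + c_k w^{k+1}`. -/
def shft (c : ℕ → F) : Sym F →ₐ[F] Polynomial (Sym F) :=
  MvPolynomial.aeval fun k =>
    Polynomial.C (MvPolynomial.X k) + Polynomial.C (MvPolynomial.C (c k)) * Polynomial.X ^ (k + 1)

/-- coefficient of `w^r` in the shift. -/
def shc (c : ℕ → F) (r : ℕ) (f : Sym F) : Sym F := (shft c f).coeff r

theorem shft_X (c : ℕ → F) (k : ℕ) : shft c (MvPolynomial.X k) =
    Polynomial.C (MvPolynomial.X k) +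
      Polynomial.C (MvPolynomial.C (c k)) * Polynomial.X ^ (k + 1) := by
  simp [shft]

theorem shft_C (c : ℕ → F) (x : F) : shft c (MvPolynomial.C x) =
    Polynomial.C (MvPolynomial.C x) := by
  have := (shft c).commutes x
  rw [MvPolynomial.algebraMap_eq] at this
  rw [this]; rfl

theorem gco_abs {K : Type*} [CommRing K] [IsDomain K] [CharZero K] (φ ψ : Sym F →+* K)
    (a : ℕ → F) (x y : K)
    (h : ∀ k, φ (MvPolynomial.C (a k) * MvPolynomial.X k) =
      ψ (MvPolynomial.C (a k) * MvPolynomial.X k) + x ^ (k + 1) - y ^ (k + 1)) (m : ℕ) :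
    φ (gco a (m + 1)) - x * φ (gco a m) = ψ (gco a (m + 1)) - y * ψ (gco a m) := by
  have hlin : ∀ z : K, (1 - PowerSeries.C z * PowerSeries.X) *
      (PowerSeries.mk fun k => z ^ (k + 1)) = PowerSeries.C z := by
    intro z
    ext1 n
    rw [sub_mul, one_mul, mul_assoc, map_sub, PowerSeries.coeff_C_mul]
    cases n with
    | zero => simp
    | succ n => rw [PowerSeries.coeff_succ_X_mul]; simp [PowerSeries.coeff_C, pow_succ]; ring
  have hd : ∀ z : K, PowerSeries.derivative K (1 - PowerSeries.C z * PowerSeries.X) =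
      - PowerSeries.C z := by
    intro z
    ext1 n
    rw [PowerSeries.coeff_derivative]
    rw [map_sub, PowerSeries.coeff_succ_mul_X]
    cases n <;> simp [PowerSeries.coeff_C, PowerSeries.coeff_one]
  have hmapd : ∀ (φ : Sym F →+* K), PowerSeries.derivative K (PowerSeries.map φ (gser a)) =
      PowerSeries.map φ (aser a) * PowerSeries.map φ (gser a) := by
    intro φ
    rw [← map_mul, ← gser_deriv]
    ext1 n
    rw [PowerSeries.coeff_derivative, PowerSeries.coeff_map, PowerSeries.coeff_map,
      PowerSeries.coeff_derivative, map_mul, map_add, map_natCast, map_one]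
  have hA : PowerSeries.map φ (aser a) = PowerSeries.map ψ (aser a) +
      (PowerSeries.mk fun k => x ^ (k + 1)) - (PowerSeries.mk fun k => y ^ (k + 1)) := by
    ext1 n
    rw [map_sub, map_add, PowerSeries.coeff_map, PowerSeries.coeff_map, PowerSeries.coeff_mk,
      PowerSeries.coeff_mk, aser, PowerSeries.coeff_mk, h]
  have key : (1 - PowerSeries.C x * PowerSeries.X) * PowerSeries.map φ (gser a) =
      (1 - PowerSeries.C y * PowerSeries.X) * PowerSeries.map ψ (gser a) := by
    refine ode_unique (PowerSeries.map ψ (aser a) - (PowerSeries.mk fun k => y ^ (k + 1)))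
      _ _ ?_ ?_ ?_
    · rw [Derivation.leibniz, hd, hmapd, hA]
      simp only [smul_eq_mul]
      linear_combination (PowerSeries.map φ (gser a)) * hlin x
    · rw [Derivation.leibniz, hd, hmapd]
      simp only [smul_eq_mul]
      linear_combination (PowerSeries.map ψ (gser a)) * hlin y
    · have h1 : ∀ χ : Sym F →+* K, PowerSeries.coeff 0 (PowerSeries.map χ (gser a)) = 1 := by
        intro χ
        rw [PowerSeries.coeff_map, gser, PowerSeries.coeff_mk, gco_zero, map_one]
      have h2 := h1 φ
      have h3 := h1 ψ
      rw [PowerSeries.coeff_zero_eq_constantCoeff] at h2 h3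
      simp [h2, h3]
  have := congrArg (PowerSeries.coeff (m + 1)) key
  rw [sub_mul, one_mul, sub_mul, one_mul, mul_assoc, mul_assoc, map_sub, map_sub,
    PowerSeries.coeff_C_mul, PowerSeries.coeff_C_mul, PowerSeries.coeff_succ_X_mul,
    PowerSeries.coeff_succ_X_mul] at this
  simpa [gser] using this

/-- The shift of a generating series: if `a_k c_k = α^{k+1} - β^{k+1}` then
`(1 - α w u) Φ(g(u)) = (1 - β w u) g(u)`. -/
theorem shft_gco (a c : ℕ → F) (α β : F) (h : ∀ k, a k * c k = α ^ (k + 1) - β ^ (k + 1))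
    (m : ℕ) :
    shft c (gco a (m + 1)) -
        Polynomial.C (MvPolynomial.C α) * Polynomial.X * shft c (gco a m)
      = Polynomial.C (gco a (m + 1)) -
        Polynomial.C (MvPolynomial.C β) * Polynomial.X * Polynomial.C (gco a m) := by
  refine gco_abs (shft c).toRingHom Polynomial.C a _ _ (fun n => ?_) m
  have e1 : (shft c).toRingHom (MvPolynomial.C (a n) * MvPolynomial.X n) =
    shft c (MvPolynomial.C (a n)) * shft c (MvPolynomial.X n) := map_mul _ _ _
  rw [e1, shft_X, shft_C, mul_pow, mul_pow, ← Polynomial.C_pow, ← Polynomial.C_pow,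
    ← MvPolynomial.C_pow, ← MvPolynomial.C_pow, mul_add, ← mul_assoc, ← Polynomial.C_mul,
    ← Polynomial.C_mul, ← MvPolynomial.C_mul, h n, MvPolynomial.C_sub, Polynomial.C_sub]
  ring

theorem shc_X_mul (c : ℕ → F) (k r : ℕ) (f : Sym F) :
    shc c r (MvPolynomial.X k * f) = MvPolynomial.X k * shc c r f +
      (if k + 1 ≤ r then MvPolynomial.C (c k) * shc c (r - (k + 1)) f else 0) := by
  rw [shc, map_mul, shft_X, add_mul, Polynomial.coeff_add, Polynomial.coeff_C_mul, mul_assoc,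
    Polynomial.coeff_C_mul, Polynomial.coeff_X_pow_mul']
  simp only [shc]
  split_ifs <;> simp

/-- `shc` as a linear map. -/
def shl (c : ℕ → F) (r : ℕ) : Sym F →ₗ[F] Sym F where
  toFun := shc c r
  map_add' := by intro f g; simp [shc]
  map_smul' := by
    intro x f
    simp only [shc, RingHom.id_apply]
    rw [map_smul, Polynomial.coeff_smul]

theorem shl_apply (c : ℕ → F) (r : ℕ) (f : Sym F) : shl c r f = shc c r f := rfl

theorem shc_C (c : ℕ → F) (r : ℕ) (x : F) :
    shc c r (MvPolynomial.C x) = if r = 0 then MvPolynomial.C x else 0 := by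
  rw [shc, shft_C, Polynomial.coeff_C]

theorem shc_one (c : ℕ → F) (r : ℕ) :
    shc c r (1 : Sym F) = if r = 0 then 1 else 0 := by
  have := shc_C c r 1
  simpa using this

theorem shc_add (c : ℕ → F) (r : ℕ) (f g : Sym F) :
    shc c r (f + g) = shc c r f + shc c r g := (shl c r).map_add f g

theorem shc_C_mul (c : ℕ → F) (r : ℕ) (x : F) (f : Sym F) :
    shc c r (MvPolynomial.C x * f) = MvPolynomial.C x * shc c r f := by
  have := (shl c r).map_smul x f
  rw [MvPolynomial.smul_eq_C_mul, MvPolynomial.smul_eq_C_mul] at this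
  exact this

theorem shc_zero' (c : ℕ → F) (r : ℕ) : shc c r (0 : Sym F) = 0 := (shl c r).map_zero

theorem shc_comm (c d : ℕ → F) (f : Sym F) : ∀ r s : ℕ,
    shc c r (shc d s f) = shc d s (shc c r f) := by
  induction f using MvPolynomial.induction_on with
  | C x =>
    intro r s
    rw [shc_C, shc_C]
    split_ifs <;> simp [shc_C, shc_zero', *]
  | add f g hf hg => intro r s; simp only [shc_add, hf, hg]
  | mul_X f k ih =>
    intro r s
    rw [mul_comm, shc_X_mul, shc_X_mul, shc_add, shc_add, shc_X_mul, shc_X_mul, ih]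
    split_ifs <;> simp [shc_C_mul, ih, shc_zero'] <;> ring

end GenSeries

section PartComb

theorem lower_finset (S : Finset ℕ) (h : ∀ i j, i ≤ j → j ∈ S → i ∈ S) (j : ℕ) :
    j < S.card ↔ j ∈ S := by
  constructor
  · intro hj
    by_contra hn
    have : S ⊆ Finset.range j := by
      intro x hx
      rw [Finset.mem_range]
      by_contra hx'
      exact hn (h j x (by omega) hx)
    have := Finset.card_le_card this
    rw [Finset.card_range] at this
    omega
  · intro hj
    have : Finset.range (j + 1) ⊆ S := by
      intro x hx
      rw [Finset.mem_range] at hx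
      exact h x j (by omega) hj
    have := Finset.card_le_card this
    rw [Finset.card_range] at this
    omega

/-- conjugate parts, 0-indexed -/
def cj (lam : Partition) (i : ℕ) : ℕ := lam.conj (i + 1)

theorem lt_cj (lam : Partition) (i j : ℕ) : j < cj lam i ↔ i < lam.part j := by
  rw [cj, Partition.conj, lower_finset]
  · simp only [Finset.mem_filter, Finsupp.mem_support_iff]
    omega
  · intro a b hab hb
    simp only [Finset.mem_filter, Finsupp.mem_support_iff] at hb ⊢
    have := lam.antitone' hab
    omega

theorem part_ext {lam mu : Partition} (h : ∀ j, lam.part j = mu.part j) : lam = mu := by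
  cases lam; cases mu
  simp only [Partition.mk.injEq]
  ext j; exact h j

theorem cj_ext {lam mu : Partition} (h : ∀ j, cj lam j = cj mu j) : lam = mu := by
  apply part_ext
  intro j
  have h1 : ∀ i, i < lam.part j ↔ i < mu.part j := by
    intro i
    rw [← lt_cj, ← lt_cj, h]
  have a := h1 (lam.part j)
  have b := h1 (mu.part j)
  omega

theorem cj_anti (lam : Partition) {i j : ℕ} (h : i ≤ j) : cj lam j ≤ cj lam i := by
  by_contra hc
  have h1 := (lt_cj lam j (cj lam i)).1 (by omega)
  have h2 := (lt_cj lam i (cj lam i)).2 (by omega)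
  omega

theorem cj_zero (lam : Partition) {i : ℕ} (h : lam.part 0 ≤ i) : cj lam i = 0 := by
  by_contra hc
  have := (lt_cj lam i 0).1 (by omega)
  omega

theorem part_zero (lam : Partition) {j : ℕ} (h : cj lam 0 ≤ j) : lam.part j = 0 := by
  by_contra hc
  have := (lt_cj lam 0 j).2 (by omega)
  omega

theorem ofConj (c : ℕ → ℕ) (hc : ∀ i j, i ≤ j → c j ≤ c i) (N : ℕ) (hN : ∀ i, N ≤ i → c i = 0) :
    ∃ nu : Partition, cj nu = c ∧ nu.part 0 ≤ N := by
  let p : ℕ → ℕ := fun j => ((Finset.range N).filter fun i => j < c i).card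
  have hp : ∀ i j, i < p j ↔ j < c i := by
    intro i j
    simp only [p]
    rw [lower_finset]
    · simp only [Finset.mem_filter, Finset.mem_range]
      constructor
      · exact fun h => h.2
      · intro h
        refine ⟨?_, h⟩
        by_contra hn
        have := hN i (by omega)
        omega
    · intro a b hab hb
      simp only [Finset.mem_filter, Finset.mem_range] at hb ⊢
      have := hc a b hab
      omega
  refine ⟨⟨Finsupp.onFinset (Finset.range (c 0)) p ?_, ?_⟩, ?_, ?_⟩
  · intro j hj
    have := (hp 0 j).1 (by omega)
    simpa using this
  · intro i j hij
    simp only [Finsupp.onFinset_apply]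
    by_contra hcon
    have h1 := (hp (p i) j).1 (by omega)
    have h2 := (hp (p i) i).2 (by omega)
    omega
  · funext i
    have h1 : ∀ j, j < cj (⟨Finsupp.onFinset (Finset.range (c 0)) p (by
        intro j hj
        have := (hp 0 j).1 (by omega)
        simpa using this), by
        intro i j hij
        simp only [Finsupp.onFinset_apply]
        by_contra hcon
        have h1 := (hp (p i) j).1 (by omega)
        have h2 := (hp (p i) i).2 (by omega)
        omega⟩ : Partition) i ↔ j < c i := by
      intro j
      rw [lt_cj]
      simp only [Finsupp.onFinset_apply]
      exact hp i j
    have a := h1 (c i)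
    have b := h1 (cj (⟨Finsupp.onFinset (Finset.range (c 0)) p (by
        intro j hj
        have := (hp 0 j).1 (by omega)
        simpa using this), by
        intro i j hij
        simp only [Finsupp.onFinset_apply]
        by_contra hcon
        have h1 := (hp (p i) j).1 (by omega)
        have h2 := (hp (p i) i).2 (by omega)
        omega⟩ : Partition) i)
    omega
  · simp only [Finsupp.onFinset_apply]
    by_contra hcon
    have h1 := (hp N 0).1 (by omega)
    have := hN N le_rfl
    omega

theorem psum_eq (lam : Partition) (N k : ℕ) (hN : lam.part 0 ≤ N) :
    lam.psum k = ∑ i ∈ Finset.range N, min (cj lam i) k := by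
  have h1 : ∀ j, lam.part j = ∑ i ∈ Finset.range N, if i < lam.part j then 1 else 0 := by
    intro j
    rw [← Finset.sum_filter, Finset.sum_const, smul_eq_mul, mul_one]
    have h0 := lam.antitone' (Nat.zero_le j)
    have : (Finset.range N).filter (fun i => i < lam.part j) = Finset.range (lam.part j) := by
      ext i; simp only [Finset.mem_filter, Finset.mem_range]; omega
    rw [this, Finset.card_range]
  have h2 : ∀ i, min (cj lam i) k = ∑ j ∈ Finset.range k, if i < lam.part j then 1 else 0 := by
    intro i
    rw [← Finset.sum_filter, Finset.sum_const, smul_eq_mul, mul_one]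
    have : (Finset.range k).filter (fun j => i < lam.part j)
        = Finset.range (min (cj lam i) k) := by
      ext j; simp only [Finset.mem_filter, Finset.mem_range, ← lt_cj]; omega
    rw [this, Finset.card_range]
  simp only [h2]
  rw [Finset.sum_comm, Partition.psum]
  exact Finset.sum_congr rfl fun j _ => h1 j

theorem size_eq_psum (lam : Partition) (k : ℕ) (hk : cj lam 0 ≤ k) : lam.size = lam.psum k := by
  rw [Partition.size, Partition.psum]
  refine Finsupp.sum_of_support_subset _ ?_ _ (by simp)
  intro j hj
  rw [Finsupp.mem_support_iff] at hj
  rw [Finset.mem_range]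
  by_contra hc
  exact hj (part_zero lam (by omega))

theorem size_eq (lam : Partition) (N : ℕ) (hN : lam.part 0 ≤ N) :
    lam.size = ∑ i ∈ Finset.range N, cj lam i := by
  rw [size_eq_psum lam (cj lam 0) le_rfl, psum_eq lam N _ hN]
  exact Finset.sum_congr rfl fun i _ => min_eq_left (cj_anti lam (Nat.zero_le i))

theorem part_le_size (lam : Partition) (j : ℕ) : lam.part j ≤ lam.size := by
  by_cases h : lam.part j = 0
  · omega
  · rw [Partition.size, Finsupp.sum]
    exact Finset.single_le_sum (f := fun j => lam.part j) (fun i _ => Nat.zero_le _)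
      (Finsupp.mem_support_iff.2 h)

theorem cj_le_size (lam : Partition) (i : ℕ) : cj lam i ≤ lam.size := by
  by_cases h : cj lam i = 0
  · omega
  · rw [size_eq lam (lam.part 0) le_rfl]
    refine Finset.single_le_sum (f := fun j => cj lam j) (fun i _ => Nat.zero_le _) ?_
    rw [Finset.mem_range]
    by_contra hc
    exact h (cj_zero lam (by omega))

theorem psum_le_size (lam : Partition) (k : ℕ) : lam.psum k ≤ lam.size := by
  rw [size_eq lam _ le_rfl, psum_eq lam _ k le_rfl]
  exact Finset.sum_le_sum fun i _ => min_le_left _ _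

theorem finite_size (n : ℕ) : {lam : Partition | lam.size = n}.Finite := by
  let f : {lam : Partition | lam.size = n} → (Fin (n + 1) → Fin (n + 1)) := fun lam j =>
    ⟨lam.1.part j, by
      have h1 := part_le_size lam.1 j
      have h2 : lam.1.size = n := lam.2
      omega⟩
  have hf : Function.Injective f := by
    intro a b hab
    apply Subtype.ext
    apply part_ext
    intro j
    by_cases hj : j ≤ n
    · have := congrArg Fin.val (congrFun hab ⟨j, by omega⟩)
      exact this
    · have ha := cj_le_size a.1 0
      have hb := cj_le_size b.1 0
      have ha2 : a.1.size = n := a.2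
      have hb2 : b.1.size = n := b.2
      rw [part_zero a.1 (by omega), part_zero b.1 (by omega)]
  have : Finite {lam : Partition | lam.size = n} := Finite.of_injective f hf
  exact Set.toFinite _

/-- the finite set of partitions of `n` -/
def psz (n : ℕ) : Finset Partition := (finite_size n).toFinset

theorem mem_psz (n : ℕ) (lam : Partition) : lam ∈ psz n ↔ lam.size = n := by
  simp [psz]

theorem mult_eq (lam : Partition) (n : ℕ) : lam.mult (n + 1) + cj lam (n + 1) = cj lam n := by
  rw [Partition.mult, cj, cj, Partition.conj, Partition.conj, ← Finset.card_union_of_disjoint]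
  · congr 1
    ext j
    simp only [Finset.mem_union, Finset.mem_filter]
    have : lam.part j = n + 1 ∨ n + 1 + 1 ≤ lam.part j ↔ n + 1 ≤ lam.part j := by omega
    tauto
  · rw [Finset.disjoint_filter]
    intro j _ h1 h2
    omega

end PartComb

section HCoeff

variable {F : Type*} [Field F]

/-- exponent vector of a partition -/
def dv (lam : Partition) : ℕ →₀ ℕ :=
  ∑ j ∈ lam.part.support, Finsupp.single (lam.part j - 1) 1

theorem pprod_eq (lam : Partition) : (pprod lam : Sym F) = MvPolynomial.monomial (dv lam) 1 := by
  rw [pprod, dv, MvPolynomial.monomial_sum_one]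
  rfl

theorem dv_apply (lam : Partition) (n : ℕ) : dv lam n = lam.mult (n + 1) := by
  rw [dv, Finsupp.finsetSum_apply, Partition.mult, Finset.card_filter]
  refine Finset.sum_congr rfl fun j hj => ?_
  rw [Finsupp.mem_support_iff] at hj
  rw [Finsupp.single_apply]
  congr 1
  apply propext
  omega

theorem wt_add (d e : ℕ →₀ ℕ) : wt (d + e) = wt d + wt e := by
  rw [wt, wt, wt, Finsupp.sum_add_index'] <;> intros <;> ring

theorem wt_single (n m : ℕ) : wt (Finsupp.single n m) = (n + 1) * m := by
  rw [wt, Finsupp.sum_single_index]; ring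

theorem wt_dv (lam : Partition) : wt (dv lam) = lam.size := by
  have : ∀ S : Finset ℕ, S ⊆ lam.part.support →
      wt (∑ j ∈ S, Finsupp.single (lam.part j - 1) 1) = ∑ j ∈ S, lam.part j := by
    intro S
    induction S using Finset.induction_on with
    | empty => intro _; simp [wt]
    | insert j S hj ih =>
      intro hS
      rw [Finset.sum_insert hj, Finset.sum_insert hj, wt_add, wt_single,
        ih (fun x hx => hS (Finset.mem_insert_of_mem hx))]
      have := Finsupp.mem_support_iff.1 (hS (Finset.mem_insert_self j S))
      omega
  exact this _ (Finset.Subset.refl _)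

theorem dv_inj {lam mu : Partition} (h : dv lam = dv mu) : lam = mu := by
  apply cj_ext
  have key : ∀ k i, i + k = lam.part 0 + mu.part 0 → cj lam i = cj mu i := by
    intro k
    induction k with
    | zero => intro i hi; rw [cj_zero lam (by omega), cj_zero mu (by omega)]
    | succ k ih =>
      intro i hi
      rw [← mult_eq, ← mult_eq mu, ih (i + 1) (by omega), ← dv_apply, ← dv_apply, h]
  intro i
  by_cases hi : i ≤ lam.part 0 + mu.part 0
  · exact key (lam.part 0 + mu.part 0 - i) i (by omega)
  · rw [cj_zero lam (by omega), cj_zero mu (by omega)]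

theorem dv_surj (d : ℕ →₀ ℕ) : ∃ lam : Partition, dv lam = d := by
  obtain ⟨N, hN⟩ : ∃ N, ∀ i, N ≤ i → d i = 0 := by
    refine ⟨d.support.sup id + 1, fun i hi => ?_⟩
    by_contra hc
    have := Finset.le_sup (f := id) (Finsupp.mem_support_iff.2 hc)
    simp only [id] at this
    omega
  obtain ⟨nu, hnu, -⟩ := ofConj (fun i => ∑ n ∈ Finset.Ico i N, d n) (by
    intro i j hij
    exact Finset.sum_le_sum_of_subset (Finset.Ico_subset_Ico hij le_rfl)) N (by
    intro i hi
    simp [Finset.Ico_eq_empty_of_le hi])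
  refine ⟨nu, ?_⟩
  ext n
  rw [dv_apply]
  have := mult_eq nu n
  rw [hnu] at this
  simp only at this
  by_cases hn : n < N
  · rw [Finset.sum_eq_sum_Ico_succ_bot hn] at this
    omega
  · rw [Finset.Ico_eq_empty_of_le (by omega), Finset.Ico_eq_empty_of_le (by omega)] at this
    rw [hN n (by omega)]
    simpa using this

/-- weight of a monomial -/
def zw (z : ℕ → F) (d : ℕ →₀ ℕ) : F := d.prod fun n m => z n ^ m * (Nat.factorial m : F)

theorem zw_add (z : ℕ → F) (d : ℕ →₀ ℕ) (i : ℕ) :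
    zw z (d + Finsupp.single i 1) = zw z d * (z i * ((d i : F) + 1)) := by
  have hs : (d + Finsupp.single i 1).support ⊆ insert i d.support := by
    intro x hx
    rw [Finsupp.mem_support_iff, Finsupp.add_apply, Finsupp.single_apply] at hx
    rw [Finset.mem_insert, Finsupp.mem_support_iff]
    by_cases h : i = x
    · exact Or.inl h.symm
    · right; simpa [h] using hx
  rw [zw, zw, Finsupp.prod_of_support_subset _ hs _ (by simp),
    Finsupp.prod_of_support_subset _ (Finset.subset_insert i d.support) _ (by simp),
    ← Finset.mul_prod_erase _ _ (Finset.mem_insert_self i _),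
    ← Finset.mul_prod_erase _ _ (Finset.mem_insert_self i _)]
  have : ∀ x ∈ (insert i d.support).erase i, z x ^ ((d + Finsupp.single i 1 : ℕ →₀ ℕ) x) *
      (Nat.factorial ((d + Finsupp.single i 1 : ℕ →₀ ℕ) x) : F) =
      z x ^ (d x) * (Nat.factorial (d x) : F) := by
    intro x hx
    have := (Finset.mem_erase.1 hx).1
    rw [Finsupp.add_apply, Finsupp.single_apply, if_neg (fun h => this h.symm), add_zero]
  rw [Finset.prod_congr rfl this, Finsupp.add_apply, Finsupp.single_apply, if_pos rfl,
    Nat.factorial_succ, pow_succ]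
  push_cast
  ring

variable [CharZero F]

theorem zw_ne_zero (z : ℕ → F) (hz : ∀ n, z n ≠ 0) (d : ℕ →₀ ℕ) : zw z d ≠ 0 := by
  rw [zw, Finsupp.prod]
  refine Finset.prod_ne_zero_iff.2 fun n _ => mul_ne_zero (pow_ne_zero _ (hz n)) ?_
  exact_mod_cast Nat.factorial_ne_zero _

theorem zee_eq (lam : Partition) : (lam.zee : F) = zw (fun n => (n : F) + 1) (dv lam) := by
  have hs : (dv lam).support ⊆ Finset.range (lam.part 0) := by
    intro x hx
    rw [Finsupp.mem_support_iff, dv_apply] at hx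
    have := mult_eq lam x
    rw [Finset.mem_range]
    by_contra hc
    rw [cj_zero lam (by omega : lam.part 0 ≤ x)] at this
    omega
  rw [zw, Finsupp.prod_of_support_subset _ hs _ (by simp), Partition.zee]
  have : Finset.Icc 1 (lam.part 0) = (Finset.range (lam.part 0)).image (· + 1) := by
    ext x
    simp only [Finset.mem_Icc, Finset.mem_image, Finset.mem_range]
    constructor
    · intro h; exact ⟨x - 1, by omega, by omega⟩
    · rintro ⟨y, hy, rfl⟩; omega
  rw [this, Finset.prod_image (by intro a _ b _ h; simpa using h)]
  push_cast
  refine Finset.prod_congr rfl fun x _ => ?_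
  rw [dv_apply]

theorem hsym_fin (r : ℕ) : hsym F r = ∑ k ∈ psz r, ((k.zee : F))⁻¹ • (pprod k : Sym F) := by
  rw [hsym]
  exact finsum_mem_eq_finite_toFinset_sum _ (finite_size r)

open Classical in
theorem hsym_coeff (r : ℕ) (d : ℕ →₀ ℕ) : MvPolynomial.coeff d (hsym F r) =
    if wt d = r then (zw (fun n => (n : F) + 1) d)⁻¹ else 0 := by
  rw [hsym_fin, MvPolynomial.coeff_sum]
  obtain ⟨lam, rfl⟩ := dv_surj d
  have : ∀ k ∈ psz r, MvPolynomial.coeff (dv lam) ((k.zee : F)⁻¹ • (pprod k : Sym F)) =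
      if k = lam then (zw (fun n => (n : F) + 1) (dv lam))⁻¹ else 0 := by
    intro k _
    rw [MvPolynomial.coeff_smul, pprod_eq, MvPolynomial.coeff_monomial, zee_eq]
    by_cases h : k = lam
    · simp [h]
    · have : dv k ≠ dv lam := fun h' => h (dv_inj h')
      simp [h, this]
  rw [Finset.sum_congr rfl this, Finset.sum_ite_eq']
  simp only [mem_psz, wt_dv]

theorem hsym_eq (r : ℕ) : hsym F r = gco (fun _ => (1 : F)) r := by
  refine gser_unique (fun _ => (1 : F)) (hsym F) ?_ ?_ r
  · ext d
    rw [hsym_coeff, MvPolynomial.coeff_one]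
    by_cases h : 0 = d
    · subst h; simp [wt, zw]
    · have : wt d ≠ 0 := by
        intro h0
        apply h
        ext n
        rw [wt, Finsupp.sum, Finset.sum_eq_zero_iff] at h0
        by_contra hn
        have h1 := h0 n (Finsupp.mem_support_iff.2 (fun h => hn h.symm))
        simp at h1
        exact hn h1.symm
      simp [h, this]
  · intro n
    ext d
    rw [MvPolynomial.coeff_sum]
    have e1 : ((n : Sym F) + 1) = MvPolynomial.C ((n : F) + 1) := by simp
    rw [e1, MvPolynomial.coeff_C_mul, hsym_coeff]
    have e2 : ∀ p ∈ Finset.HasAntidiagonal.antidiagonal n, MvPolynomial.coeff d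
        (MvPolynomial.C 1 * MvPolynomial.X p.1 * hsym F p.2) =
        if wt d = n + 1 then (((p.1 + 1) * d p.1 : ℕ) : F) * (zw (fun n => (n : F) + 1) d)⁻¹
          else 0 := by
      intro p hp
      have hp := Finset.HasAntidiagonal.mem_antidiagonal.1 hp
      rw [MvPolynomial.C_1, one_mul, MvPolynomial.coeff_X_mul']
      by_cases hd : p.1 ∈ d.support
      · rw [if_pos hd]
        obtain ⟨d', rfl⟩ : ∃ d', d = d' + Finsupp.single p.1 1 := by
          refine ⟨d - Finsupp.single p.1 1, ?_⟩
          ext x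
          rw [Finsupp.mem_support_iff] at hd
          simp only [Finsupp.add_apply, Finsupp.tsub_apply, Finsupp.single_apply]
          split_ifs with h
          · subst h; omega
          · omega
        rw [add_tsub_cancel_right, hsym_coeff, wt_add, wt_single, zw_add]
        have hiff : (wt d' = p.2) = (wt d' + (p.1 + 1) * 1 = n + 1) := by
          apply propext; omega
        simp only [hiff]
        split_ifs with h
        · have h1 : ((p.1 : F) + 1) ≠ 0 := by exact_mod_cast Nat.succ_ne_zero p.1
          have h2 : ((d' p.1 : F) + 1) ≠ 0 := by exact_mod_cast Nat.succ_ne_zero (d' p.1)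
          rw [mul_inv, mul_inv]
          simp only [Finsupp.add_apply, Finsupp.single_apply, if_true]
          push_cast
          field_simp
        · rfl
      · rw [if_neg hd]
        rw [Finsupp.mem_support_iff, not_not] at hd
        simp [hd]
    rw [Finset.sum_congr rfl e2]
    by_cases hw : wt d = n + 1
    · simp only [hw, if_true]
      rw [← Finset.sum_mul, ← Nat.cast_sum]
      congr 1
      have : ∑ p ∈ Finset.HasAntidiagonal.antidiagonal n, (p.1 + 1) * d p.1 = n + 1 := by
        rw [Finset.Nat.sum_antidiagonal_eq_sum_range_succ (fun i j => (i + 1) * d i), ← hw, wt]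
        symm
        refine Finsupp.sum_of_support_subset _ ?_ _ (by simp)
        intro x hx
        rw [Finset.mem_range]
        have h1 : (x + 1) * d x ≤ wt d := by
          rw [wt, Finsupp.sum]
          exact Finset.single_le_sum (f := fun x => (x + 1) * d x) (fun i _ => Nat.zero_le _) hx
        rw [Finsupp.mem_support_iff] at hx
        have h2 : x + 1 ≤ (x + 1) * d x := Nat.le_mul_of_pos_right _ (by omega)
        omega
      rw [this]; push_cast; ring
    · simp [hw]

end HCoeff

section InnerProd

variable {F : Type*} [Field F]

/-- weighted inner product -/
def ip (z : ℕ → F) (f g : Sym F) : F :=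
  ∑ d ∈ f.support, f.coeff d * g.coeff d * zw z d

theorem innerQT_eq (q t : F) (f g : Sym F) : innerQT q t f g =
    ip (fun n => ((n : F) + 1) * ((1 - q ^ (n + 1)) / (1 - t ^ (n + 1)))) f g := by
  rw [innerQT, ip]
  refine Finset.sum_congr rfl fun d _ => ?_
  congr 1
  rw [zw]
  refine Finsupp.prod_congr fun n _ => ?_
  rw [mul_pow]; ring

theorem ip_sub (z : ℕ → F) (f g : Sym F) (S : Finset (ℕ →₀ ℕ)) (hS : f.support ⊆ S) :
    ip z f g = ∑ d ∈ S, f.coeff d * g.coeff d * zw z d := by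
  rw [ip]
  refine Finset.sum_subset hS fun d _ hd => ?_
  rw [MvPolynomial.notMem_support_iff.1 hd]; ring

theorem ip_comm (z : ℕ → F) (f g : Sym F) : ip z f g = ip z g f := by
  classical
  rw [ip_sub z f g (f.support ∪ g.support) Finset.subset_union_left,
    ip_sub z g f (f.support ∪ g.support) Finset.subset_union_right]
  exact Finset.sum_congr rfl fun d _ => by ring

theorem ip_add_right (z : ℕ → F) (f g h : Sym F) : ip z f (g + h) = ip z f g + ip z f h := by
  rw [ip, ip, ip, ← Finset.sum_add_distrib]
  exact Finset.sum_congr rfl fun d _ => by rw [MvPolynomial.coeff_add]; ring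

theorem ip_smul_right (z : ℕ → F) (x : F) (f g : Sym F) : ip z f (x • g) = x * ip z f g := by
  rw [ip, ip, Finset.mul_sum]
  exact Finset.sum_congr rfl fun d _ => by rw [MvPolynomial.coeff_smul, smul_eq_mul]; ring

theorem ip_add_left (z : ℕ → F) (f g h : Sym F) : ip z (f + g) h = ip z f h + ip z g h := by
  rw [ip_comm, ip_add_right, ip_comm z h, ip_comm z h]

theorem ip_smul_left (z : ℕ → F) (x : F) (f g : Sym F) : ip z (x • f) g = x * ip z f g := by
  rw [ip_comm, ip_smul_right, ip_comm]

/-- `ip` as a linear map in the second argument -/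
def ipR (z : ℕ → F) (f : Sym F) : Sym F →ₗ[F] F where
  toFun := ip z f
  map_add' := ip_add_right z f
  map_smul' := fun x g => ip_smul_right z x f g

/-- `ip` as a linear map in the first argument -/
def ipL (z : ℕ → F) (g : Sym F) : Sym F →ₗ[F] F where
  toFun := fun f => ip z f g
  map_add' := fun f h => ip_add_left z f h g
  map_smul' := fun x f => ip_smul_left z x f g

theorem ip_zero_left (z : ℕ → F) (g : Sym F) : ip z 0 g = 0 := (ipL z g).map_zero
theorem ip_zero_right (z : ℕ → F) (g : Sym F) : ip z g 0 = 0 := (ipR z g).map_zero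
theorem ip_sub_left (z : ℕ → F) (f h g : Sym F) : ip z (f - h) g = ip z f g - ip z h g :=
  (ipL z g).map_sub f h
theorem ip_sub_right (z : ℕ → F) (g f h : Sym F) : ip z g (f - h) = ip z g f - ip z g h :=
  (ipR z g).map_sub f h
theorem ip_neg_right (z : ℕ → F) (g f : Sym F) : ip z g (-f) = - ip z g f :=
  (ipR z g).map_neg f
theorem ip_sum_left {ι : Type*} (z : ℕ → F) (g : Sym F) (S : Finset ι) (f : ι → Sym F) :
    ip z (∑ i ∈ S, f i) g = ∑ i ∈ S, ip z (f i) g := map_sum (ipL z g) f S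
theorem ip_sum_right {ι : Type*} (z : ℕ → F) (g : Sym F) (S : Finset ι) (f : ι → Sym F) :
    ip z g (∑ i ∈ S, f i) = ∑ i ∈ S, ip z g (f i) := map_sum (ipR z g) f S

theorem ip_monomial (z : ℕ → F) (d : ℕ →₀ ℕ) (a : F) (g : Sym F) :
    ip z (MvPolynomial.monomial d a) g = a * g.coeff d * zw z d := by
  classical
  rw [ip_sub z _ g {d} MvPolynomial.support_monomial_subset, Finset.sum_singleton,
    MvPolynomial.coeff_monomial, if_pos rfl]

theorem ip_X_mul (z : ℕ → F) (k : ℕ) (f g : Sym F) :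
    ip z f (MvPolynomial.X k * g) = z k * ip z (MvPolynomial.pderiv k f) g := by
  induction f using MvPolynomial.induction_on' with
  | add p q hp hq => rw [ip_add_left, map_add, ip_add_left, hp, hq]; ring
  | monomial d a =>
    rw [ip_monomial, MvPolynomial.pderiv_monomial, ip_monomial, MvPolynomial.coeff_X_mul']
    by_cases hd : k ∈ d.support
    · rw [if_pos hd]
      obtain ⟨d', rfl⟩ : ∃ d', d = d' + Finsupp.single k 1 := by
        refine ⟨d - Finsupp.single k 1, ?_⟩
        ext x
        rw [Finsupp.mem_support_iff] at hd
        simp only [Finsupp.add_apply, Finsupp.tsub_apply, Finsupp.single_apply]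
        split_ifs with h
        · subst h; omega
        · omega
      rw [add_tsub_cancel_right, zw_add]
      simp only [Finsupp.add_apply, Finsupp.single_apply, if_true]
      push_cast
      ring
    · rw [if_neg hd]
      rw [Finsupp.mem_support_iff, not_not] at hd
      simp [hd]

variable [CharZero F]

theorem pderiv_gco (a : ℕ → F) (k r : ℕ) : MvPolynomial.pderiv k (gco a r) =
    if k + 1 ≤ r then MvPolynomial.C (a k / ((k : F) + 1)) * gco a (r - (k + 1)) else 0 := by
  induction r using Nat.strong_induction_on with
  | _ r ih =>
    cases r with
    | zero => simp [gco_zero]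
    | succ r =>
      have hr : ((r : Sym F) + 1) ≠ 0 := by exact_mod_cast Nat.succ_ne_zero r
      have hk : ((k : F) + 1) ≠ 0 := by exact_mod_cast Nat.succ_ne_zero k
      apply mul_left_cancel₀ hr
      have e0 : ((r : Sym F) + 1) = MvPolynomial.C ((r : F) + 1) := by simp
      have e1 : ((r : Sym F) + 1) * MvPolynomial.pderiv k (gco a (r + 1)) =
          MvPolynomial.pderiv k (((r : Sym F) + 1) * gco a (r + 1)) := by
        rw [e0, MvPolynomial.pderiv_C_mul]
      rw [e1, gco_rec, map_sum]
      have e2 : ∀ p ∈ Finset.HasAntidiagonal.antidiagonal r, MvPolynomial.pderiv k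
          (MvPolynomial.C (a p.1) * MvPolynomial.X p.1 * gco a p.2) =
          (if p.1 = k then MvPolynomial.C (a k) * gco a p.2 else 0) +
          (if k + 1 ≤ p.2 then MvPolynomial.C (a k / ((k : F) + 1)) *
            (MvPolynomial.C (a p.1) * MvPolynomial.X p.1 * gco a (p.2 - (k + 1))) else 0) := by
        intro p hp
        have hp := Finset.HasAntidiagonal.mem_antidiagonal.1 hp
        rw [Derivation.leibniz, ih p.2 (by omega), MvPolynomial.pderiv_C_mul,
          MvPolynomial.pderiv_X, smul_eq_mul, smul_eq_mul, add_comm]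
        congr 1
        · by_cases h : p.1 = k
          · subst h; simp; ring
          · simp [h, Pi.single_apply]
        · split_ifs
          · ring
          · simp
      rw [Finset.sum_congr rfl e2, Finset.sum_add_distrib,
        Finset.Nat.sum_antidiagonal_eq_sum_range_succ (fun i j =>
          if i = k then MvPolynomial.C (a k) * gco a j else 0),
        Finset.Nat.sum_antidiagonal_eq_sum_range_succ (fun i j =>
          if k + 1 ≤ j then MvPolynomial.C (a k / ((k : F) + 1)) *
            (MvPolynomial.C (a i) * MvPolynomial.X i * gco a (j - (k + 1))) else 0),
        Finset.sum_ite_eq']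
      simp only [Finset.mem_range]
      by_cases hkr : k < r.succ
      · rw [if_pos hkr, if_pos (by omega)]
        rcases Nat.lt_or_ge k r with hlt | hge
        · obtain ⟨s, rfl⟩ : ∃ s, r = k + 1 + s := ⟨r - (k + 1), by omega⟩
          have e3 : ∑ i ∈ Finset.range (k + 1 + s).succ, (if k + 1 ≤ k + 1 + s - i then
              MvPolynomial.C (a k / ((k : F) + 1)) * (MvPolynomial.C (a i) * MvPolynomial.X i *
                gco a (k + 1 + s - i - (k + 1))) else 0) =
              MvPolynomial.C (a k / ((k : F) + 1)) * (((s : Sym F) + 1) * gco a (s + 1)) := by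
            rw [gco_rec, Finset.Nat.sum_antidiagonal_eq_sum_range_succ (fun i j =>
              MvPolynomial.C (a i) * MvPolynomial.X i * gco a j), Finset.mul_sum]
            symm
            have hss : Finset.range s.succ ⊆ Finset.range (k + 1 + s).succ := by
              intro x; simp only [Finset.mem_range]; omega
            rw [← Finset.sum_subset hss]
            · refine Finset.sum_congr rfl fun i hi => ?_
              rw [Finset.mem_range] at hi
              rw [if_pos (by omega)]
              congr 3
              omega
            · intro x hx hx'
              rw [Finset.mem_range] at hx hx'
              rw [if_neg (by omega)]
          rw [e3]
          have e4 : k + 1 + s - k = s + 1 := by omega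
          have e5 : k + 1 + s + 1 - (k + 1) = s + 1 := by omega
          rw [e4, e5, e0]
          have e6 : ((s : Sym F) + 1) = MvPolynomial.C ((s : F) + 1) := by simp
          rw [e6, ← mul_assoc, ← mul_assoc, ← add_mul, ← map_mul, ← map_mul, ← map_add]
          congr 2
          push_cast
          field_simp
          ring
        · have : r = k := by omega
          subst this
          rw [Finset.sum_eq_zero, add_zero, e0, ← mul_assoc, ← map_mul]
          · rw [show r + 1 - (r + 1) = r - r by omega]
            congr 2
            field_simp
          · intro i _
            rw [if_neg (by omega)]
      · rw [if_neg hkr, if_neg (by omega), zero_add, mul_zero]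
        refine Finset.sum_eq_zero fun i _ => ?_
        rw [if_neg (by omega)]

/-- adjunction between multiplication by a generating series and a shift -/
theorem ip_gco (z a : ℕ → F) (c : ℕ → F) (hc : ∀ k, c k = a k * z k / ((k : F) + 1))
    (f : Sym F) : ∀ (r : ℕ) (g : Sym F), ip z f (gco a r * g) = ip z (shc c r f) g := by
  induction f using MvPolynomial.induction_on with
  | C x =>
    intro r g
    rw [shc_C]
    have h1 : ∀ g : Sym F, ip z (MvPolynomial.C x) g = x * MvPolynomial.constantCoeff g := by
      intro g
      have := ip_monomial z 0 x g
      rw [show MvPolynomial.monomial (0 : ℕ →₀ ℕ) x = MvPolynomial.C x from rfl] at this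
      rw [this, zw, Finsupp.prod_zero_index, mul_one]; rfl
    by_cases hr : r = 0
    · subst hr; simp [gco_zero]
    · rw [h1, if_neg hr, map_mul, gco_const a r hr, ip_zero_left]; ring
  | add f g hf hg => intro r g; rw [shc_add, ip_add_left, ip_add_left, hf, hg]
  | mul_X f k ih =>
    intro r g
    rw [mul_comm f, shc_X_mul, ip_comm, ip_X_mul, ip_comm, Derivation.leibniz, smul_eq_mul,
      smul_eq_mul, ip_add_right, ih, pderiv_gco, ip_add_left, ip_comm z (_ * shc c r f), ip_X_mul,
      ip_comm z _ (shc c r f), mul_add]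
    congr 1
    split_ifs with h
    · rw [mul_left_comm, ← MvPolynomial.smul_eq_C_mul, ip_smul_right, mul_comm g, ih,
        ← MvPolynomial.smul_eq_C_mul, ip_smul_left, hc]
      ring
    · rw [mul_zero, ip_zero_right, ip_zero_left, mul_zero]

theorem ip_nondeg (z : ℕ → F) (hz : ∀ n, z n ≠ 0) (f : Sym F) (h : ∀ g, ip z f g = 0) :
    f = 0 := by
  ext d
  have := h (MvPolynomial.monomial d 1)
  rw [ip_comm, ip_monomial, one_mul] at this
  rcases mul_eq_zero.1 this with h1 | h1
  · simpa using h1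
  · exact absurd h1 (zw_ne_zero z hz d)

end InnerProd

section QBin

variable {F : Type*} [Field F]

theorem qint_add (t : F) (m n : ℕ) : qint t (m + n) = qint t m + t ^ m * qint t n := by
  rw [qint, qint, qint, Finset.sum_range_add, Finset.mul_sum]
  simp only [pow_add]

theorem qint_ne_zero (t : F) (ht : ∀ n : ℕ, 0 < n → t ^ n ≠ 1) (n : ℕ) : qint t (n + 1) ≠ 0 := by
  intro h
  have := mul_geom_sum t (n + 1)
  rw [qint] at h
  rw [h, mul_zero] at this
  exact ht (n + 1) (by omega) (sub_eq_zero.1 this.symm)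

theorem qfac_succ (t : F) (n : ℕ) : qfac t (n + 1) = qfac t n * qint t (n + 1) := by
  rw [qfac, qfac, Finset.prod_range_succ]

theorem qfac_zero (t : F) : qfac t 0 = 1 := by simp [qfac]

theorem qfac_ne_zero (t : F) (ht : ∀ n : ℕ, 0 < n → t ^ n ≠ 1) (n : ℕ) : qfac t n ≠ 0 := by
  rw [qfac]
  exact Finset.prod_ne_zero_iff.2 fun j _ => qint_ne_zero t ht j

theorem qbinom_nat (t : F) (k j : ℕ) :
    qbinom t ((k + j : ℕ) : ℤ) (k : ℤ) = qfac t (k + j) / (qfac t k * qfac t j) := by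
  rw [qbinom, if_pos ⟨by omega, by omega⟩]
  have h1 : ((k + j : ℕ) : ℤ).toNat = k + j := by omega
  have h2 : (k : ℤ).toNat = k := by omega
  have h3 : (((k + j : ℕ) : ℤ) - k).toNat = j := by omega
  rw [h1, h2, h3]

theorem qbinom_gt (t : F) (n k : ℤ) (h : n < k) : qbinom t n k = 0 := by
  rw [qbinom, if_neg]; omega

theorem qbinom_neg (t : F) (n k : ℤ) (h : k < 0) : qbinom t n k = 0 := by
  rw [qbinom, if_neg]; omega

theorem qbinom_zero (t : F) (ht : ∀ n : ℕ, 0 < n → t ^ n ≠ 1) (n : ℕ) :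
    qbinom t (n : ℤ) 0 = 1 := by
  have := qbinom_nat t 0 n
  rw [zero_add, qfac_zero, one_mul, div_self (qfac_ne_zero t ht n)] at this
  exact_mod_cast this

theorem qbinom_self (t : F) (ht : ∀ n : ℕ, 0 < n → t ^ n ≠ 1) (n : ℕ) :
    qbinom t (n : ℤ) (n : ℤ) = 1 := by
  have := qbinom_nat t n 0
  rw [add_zero, qfac_zero, mul_one, div_self (qfac_ne_zero t ht n)] at this
  exact_mod_cast this

theorem qbinom_pascal (t : F) (ht : ∀ n : ℕ, 0 < n → t ^ n ≠ 1) (m k : ℕ) (hk : k ≤ m) :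
    qbinom t ((m + 1 : ℕ) : ℤ) ((k + 1 : ℕ) : ℤ) =
      qbinom t (m : ℤ) ((k + 1 : ℕ) : ℤ) + t ^ (m - k) * qbinom t (m : ℤ) (k : ℤ) := by
  rcases Nat.lt_or_ge k m with h | h
  · obtain ⟨j, rfl⟩ : ∃ j, m = k + 1 + j := ⟨m - (k + 1), by omega⟩
    have e1 := qbinom_nat t (k + 1) (j + 1)
    have e2 := qbinom_nat t (k + 1) j
    have e3 := qbinom_nat t k (j + 1)
    rw [show k + (j + 1) = k + 1 + j by ring] at e3
    rw [show k + 1 + (j + 1) = k + 1 + j + 1 by ring] at e1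
    rw [e1, e2, e3, show k + 1 + j - k = j + 1 by omega, qfac_succ t (k + 1 + j), qfac_succ t k,
      qfac_succ t j, show k + 1 + j + 1 = (j + 1) + (k + 1) by ring, qint_add t (j + 1)]
    have h1 := qfac_ne_zero t ht k
    have h2 := qfac_ne_zero t ht j
    have h3 := qint_ne_zero t ht k
    have h4 := qint_ne_zero t ht j
    field_simp
  · have : k = m := by omega
    subst this
    rw [qbinom_self t ht, qbinom_self t ht, qbinom_gt t _ _ (by push_cast; omega)]
    simp

/-- the noncommutative `t`-binomial theorem -/
theorem qbinom_thm {A : Type*} [Ring A] [Algebra F A] (t : F)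
    (ht : ∀ n : ℕ, 0 < n → t ^ n ≠ 1) (x y : A) (h : y * x = t • (x * y)) (m : ℕ) :
    (x + y) ^ m = ∑ k ∈ Finset.range (m + 1),
      qbinom t (m : ℤ) (k : ℤ) • (x ^ (m - k) * y ^ k) := by
  have hpow : ∀ j, y * x ^ j = t ^ j • (x ^ j * y) := by
    intro j
    induction j with
    | zero => simp
    | succ j ih =>
      rw [pow_succ x, ← mul_assoc, ih, smul_mul_assoc, mul_assoc, h, mul_smul_comm, smul_smul,
        pow_succ, mul_assoc]
  induction m with
  | zero => simp [qbinom, qfac]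
  | succ m ih =>
    rw [pow_succ', ih, add_mul, Finset.mul_sum, Finset.mul_sum, Finset.sum_range_succ',
      Finset.sum_range_succ (fun k => y * _), Finset.sum_range_succ' _ (m + 1),
      Finset.sum_range_succ _ m]
    have e0 : x * (qbinom t (m : ℤ) ((0 : ℕ) : ℤ) • (x ^ (m - 0) * y ^ 0)) =
        qbinom t ((m + 1 : ℕ) : ℤ) ((0 : ℕ) : ℤ) • (x ^ (m + 1 - 0) * y ^ 0) := by
      rw [Nat.cast_zero, qbinom_zero t ht, qbinom_zero t ht]
      simp [pow_succ']
    have e1 : y * (qbinom t (m : ℤ) (m : ℤ) • (x ^ (m - m) * y ^ m)) =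
        qbinom t ((m + 1 : ℕ) : ℤ) ((m + 1 : ℕ) : ℤ) • (x ^ (m + 1 - (m + 1)) * y ^ (m + 1)) := by
      rw [qbinom_self t ht, qbinom_self t ht]
      simp [pow_succ']
    rw [e0, e1]
    have e2 : ∀ k ∈ Finset.range m, qbinom t ((m + 1 : ℕ) : ℤ) ((k + 1 : ℕ) : ℤ) •
        (x ^ (m + 1 - (k + 1)) * y ^ (k + 1)) =
        x * (qbinom t (m : ℤ) ((k + 1 : ℕ) : ℤ) • (x ^ (m - (k + 1)) * y ^ (k + 1))) +
        y * (qbinom t (m : ℤ) (k : ℤ) • (x ^ (m - k) * y ^ k)) := by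
      intro k hk
      rw [Finset.mem_range] at hk
      rw [qbinom_pascal t ht m k (by omega), mul_smul_comm, mul_smul_comm, ← mul_assoc,
        ← mul_assoc, hpow, ← pow_succ', show m - (k + 1) + 1 = m - k by omega, smul_mul_assoc,
        mul_assoc, ← pow_succ', smul_smul, add_smul, show m + 1 - (k + 1) = m - k by omega,
        mul_comm (t ^ (m - k))]
    rw [Finset.sum_congr rfl e2, Finset.sum_add_distrib]
    abel

end QBin

section Vertex

variable {F : Type*} [Field F]

/-- parameters -/
def qcf (t : F) : ℕ → F := fun k => 1 - t ^ (k + 1)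
def ecf : ℕ → F := fun k => (-1) ^ k
def cT : ℕ → F := fun _ => -1
def cR (t : F) : ℕ → F := fun k => (-1) ^ k / (1 - t ^ (k + 1))

/-- `q_n` and `e_n` -/
def qf (t : F) (n : ℕ) : Sym F := gco (qcf t) n
def ef (F : Type*) [Field F] (n : ℕ) : Sym F := gco (ecf : ℕ → F) n

theorem ef_zero : ef F 0 = 1 := gco_zero _
theorem qf_zero (t : F) : qf t 0 = 1 := gco_zero _

/-- contraction of the shift variable with `q` -/
def Lq (t : F) (n : ℕ) : Polynomial (Sym F) →ₗ[Sym F] Sym F :=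
  Polynomial.lsum fun k => LinearMap.toSpanSingleton (Sym F) (Sym F) (qf t (n + k))

theorem Lq_monomial (t : F) (n k : ℕ) (a : Sym F) :
    Lq t n (Polynomial.monomial k a) = a * qf t (n + k) := by
  rw [Lq, Polynomial.lsum_apply, Polynomial.sum_monomial_index]
  · simp
  · simp

theorem Lq_C_mul (t : F) (n : ℕ) (a : Sym F) (y : Polynomial (Sym F)) :
    Lq t n (Polynomial.C a * y) = a * Lq t n y := by
  rw [← Polynomial.smul_eq_C_mul, map_smul, smul_eq_mul]

theorem Lq_X_mul (t : F) (n : ℕ) (y : Polynomial (Sym F)) :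
    Lq t n (Polynomial.X * y) = Lq t (n + 1) y := by
  induction y using Polynomial.induction_on' with
  | add p q hp hq => rw [mul_add, map_add, map_add, hp, hq]
  | monomial k a =>
    rw [Polynomial.X_mul_monomial, Lq_monomial, Lq_monomial,
      show n + (k + 1) = n + 1 + k by ring]

theorem Lq_range (t : F) (n N : ℕ) (y : Polynomial (Sym F)) (h : ∀ k, N ≤ k → y.coeff k = 0) :
    Lq t n y = ∑ k ∈ Finset.range N, y.coeff k * qf t (n + k) := by
  have hs : y.support ⊆ Finset.range N := by
    intro k hk
    rw [Polynomial.mem_support_iff] at hk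
    rw [Finset.mem_range]
    by_contra hc
    exact hk (h k (by omega))
  rw [Lq, Polynomial.lsum_apply, Polynomial.sum_eq_of_subset _ (by simp) hs]
  simp

variable [CharZero F]

/-- the vertex operator -/
def Bv (t : F) (n : ℕ) : Sym F →ₗ[F] Sym F where
  toFun := fun f => Lq t n (shft cT f)
  map_add' := by intro f g; rw [map_add, map_add]
  map_smul' := by
    intro x f
    rw [map_smul, RingHom.id_apply]
    have : x • shft cT f = (MvPolynomial.C x : Sym F) • shft cT f := by
      rw [← algebraMap_smul (Sym F) x (shft cT f)]; rfl
    rw [this, map_smul, MvPolynomial.smul_eq_C_mul, smul_eq_mul]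

theorem Bv_apply (t : F) (n : ℕ) (f : Sym F) : Bv t n f = Lq t n (shft cT f) := rfl

theorem Bv_one (t : F) (n : ℕ) : Bv t n 1 = qf t n := by
  rw [Bv_apply, map_one, ← Polynomial.monomial_zero_one, Lq_monomial]; simp

theorem Bv_e (t : F) (n r : ℕ) (f : Sym F) :
    ef F (r + 1) * Bv t n f = Bv t n (ef F (r + 1) * f) + Bv t (n + 1) (ef F r * f) := by
  have h := shft_gco (ecf : ℕ → F) cT (-1) 0 (by intro k; simp [ecf, cT, pow_succ]) r
  have h2 : Polynomial.C (ef F (r + 1)) =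
      shft cT (ef F (r + 1)) + Polynomial.X * shft cT (ef F r) := by
    rw [ef, ef]
    simp only [map_neg, map_one, map_zero, zero_mul, sub_zero] at h
    rw [← h]; ring
  rw [Bv_apply, ← Lq_C_mul, h2, add_mul, map_add, mul_assoc, Lq_X_mul, ← map_mul, ← map_mul]
  rfl

/-- the double contraction -/
def Zq (t : F) (n m : ℕ) : Polynomial (Sym F) →ₗ[F] Sym F :=
  Polynomial.lsum fun k => (LinearMap.mulLeft F (qf t (m + k))) ∘ₗ (Bv t n)

theorem Zq_monomial (t : F) (n m k : ℕ) (a : Sym F) :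
    Zq t n m (Polynomial.monomial k a) = qf t (m + k) * Bv t n a := by
  rw [Zq, Polynomial.lsum_apply, Polynomial.sum_monomial_index]
  · simp
  · simp

theorem Zq_range (t : F) (n m N : ℕ) (y : Polynomial (Sym F))
    (h : ∀ k, N ≤ k → y.coeff k = 0) :
    Zq t n m y = ∑ k ∈ Finset.range N, qf t (m + k) * Bv t n (y.coeff k) := by
  have hs : y.support ⊆ Finset.range N := by
    intro k hk
    rw [Polynomial.mem_support_iff] at hk
    rw [Finset.mem_range]
    by_contra hc
    exact hk (h k (by omega))
  rw [Zq, Polynomial.lsum_apply, Polynomial.sum_eq_of_subset _ (by simp) hs]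
  simp

theorem BL_rel (t : F) (n m : ℕ) (y : Polynomial (Sym F)) :
    Bv t n (Lq t (m + 1) y) - t • Bv t (n + 1) (Lq t m y) =
      Zq t n (m + 1) y - Zq t (n + 1) m y := by
  induction y using Polynomial.induction_on' with
  | add p q hp hq =>
    simp only [map_add, smul_add]
    rw [add_sub_add_comm, hp, hq]; abel
  | monomial k a =>
    rw [Lq_monomial, Lq_monomial, Zq_monomial, Zq_monomial]
    have h := shft_gco (qcf t) cT t 1 (by intro k; simp [qcf, cT]) (m + k)
    simp only [map_one, one_mul] at h
    have h2 : shft cT (qf t (m + 1 + k)) = Polynomial.C (MvPolynomial.C t) *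
        (Polynomial.X * shft cT (qf t (m + k))) + Polynomial.C (qf t (m + 1 + k)) -
        Polynomial.C (qf t (m + k)) * Polynomial.X := by
      rw [show m + 1 + k = m + k + 1 by ring]
      rw [qf, qf]
      linear_combination h
    have e : shft cT (a * qf t (m + 1 + k)) =
        Polynomial.C (MvPolynomial.C t) * (Polynomial.X * shft cT (a * qf t (m + k))) +
        Polynomial.C (qf t (m + 1 + k)) * shft cT a -
        Polynomial.C (qf t (m + k)) * (Polynomial.X * shft cT a) := by
      rw [map_mul, map_mul, h2]; ring
    rw [Bv_apply, e, map_sub, map_add, Lq_C_mul, Lq_C_mul, Lq_C_mul, Lq_X_mul, Lq_X_mul,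
      MvPolynomial.smul_eq_C_mul, Bv_apply, Bv_apply, Bv_apply]
    ring

theorem shft_bound (c : ℕ → F) (f : Sym F) :
    ∃ N, ∀ k, N ≤ k → shc c k f = 0 :=
  ⟨(shft c f).natDegree + 1, fun k hk => Polynomial.coeff_eq_zero_of_natDegree_lt (by omega)⟩

theorem Zq_symm (t : F) (n m : ℕ) (f : Sym F) :
    Zq t n m (shft cT f) = Zq t m n (shft cT f) := by
  obtain ⟨N, hN⟩ := shft_bound (cT : ℕ → F) f
  rw [Zq_range t n m N _ hN, Zq_range t m n N _ hN]
  have : ∀ n k, Bv t n ((shft cT f).coeff k) =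
      ∑ j ∈ Finset.range N, shc cT j (shc cT k f) * qf t (n + j) := by
    intro n k
    rw [Bv_apply]
    refine Lq_range t n N _ fun j hj => ?_
    change shc cT j (shc cT k f) = 0
    rw [shc_comm, hN j hj, shc_zero']
  simp only [this, Finset.mul_sum]
  rw [Finset.sum_comm]
  refine Finset.sum_congr rfl fun k _ => Finset.sum_congr rfl fun j _ => ?_
  rw [shc_comm]; ring

theorem Bv_rel (t : F) (n : ℕ) (f : Sym F) :
    Bv t n (Bv t (n + 1) f) = t • Bv t (n + 1) (Bv t n f) := by
  have := BL_rel t n n (shft cT f)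
  rw [Zq_symm t n (n + 1), sub_self] at this
  exact sub_eq_zero.1 this

theorem shc_id (c : ℕ → F) (f : Sym F) : shc c 0 f = f := by
  induction f using MvPolynomial.induction_on with
  | C x => simp [shc_C]
  | add f g hf hg => rw [shc_add, hf, hg]
  | mul_X f k ih => rw [mul_comm, shc_X_mul, ih]; simp

theorem cR_mul (t : F) (ht : ∀ n : ℕ, 0 < n → t ^ n ≠ 1) (k : ℕ) :
    qcf t k * cR t k = (-1) ^ k := by
  rw [qcf, cR, mul_div_cancel₀]
  exact fun h => ht (k + 1) (by omega) (sub_eq_zero.1 h).symm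

theorem shc_qf (t : F) (ht : ∀ n : ℕ, 0 < n → t ^ n ≠ 1) (r m : ℕ) (a : Sym F) :
    shc (cR t) (r + 1) (a * qf t (m + 1)) =
      shc (cR t) (r + 1) a * qf t (m + 1) + shc (cR t) r a * qf t m := by
  have h := shft_gco (qcf t) (cR t) 0 (-1) (by
    intro k; rw [cR_mul t ht]; simp [pow_succ]) m
  simp only [map_neg, map_one, map_zero, zero_mul, sub_zero] at h
  replace h : (shft (cR t)) (gco (qcf t) (m + 1)) = Polynomial.C (gco (qcf t) (m + 1)) +
    Polynomial.X * Polynomial.C (gco (qcf t) m) := by rw [h]; ring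
  rw [shc, map_mul, qf, h, mul_add, Polynomial.coeff_add, Polynomial.coeff_mul_C, ← mul_assoc,
    Polynomial.coeff_mul_C, Polynomial.coeff_mul_X]
  rfl

theorem shc_Bv (t : F) (ht : ∀ n : ℕ, 0 < n → t ^ n ≠ 1) (r n : ℕ) (f : Sym F) :
    shc (cR t) (r + 1) (Bv t (n + 1) f) =
      Bv t (n + 1) (shc (cR t) (r + 1) f) + Bv t n (shc (cR t) r f) := by
  obtain ⟨N, hN⟩ := shft_bound (cT : ℕ → F) f
  have hN2 : ∀ s k, N ≤ k → (shft cT (shc (cR t) s f)).coeff k = 0 := by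
    intro s k hk
    change shc cT k (shc (cR t) s f) = 0
    rw [shc_comm, hN k hk, shc_zero']
  rw [Bv_apply, Bv_apply, Bv_apply, Lq_range t _ N _ hN, Lq_range t _ N _ (hN2 _),
    Lq_range t _ N _ (hN2 _), ← Finset.sum_add_distrib, ← shl_apply, map_sum]
  refine Finset.sum_congr rfl fun k _ => ?_
  rw [shl_apply, show n + 1 + k = n + k + 1 by ring, shc_qf t ht]
  change shc _ _ (shc _ _ _) * _ + shc _ _ (shc _ _ _) * _ = _
  rw [shc_comm, shc_comm (cR t)]
  rfl

theorem Bv_ef (t : F) (r : ℕ) : ∀ n, Bv t n (ef F r) = ∑ p ∈ Finset.HasAntidiagonal.antidiagonal r,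
    (-1) ^ p.1 * qf t (n + p.1) * ef F p.2 := by
  induction r with
  | zero => intro n; rw [ef_zero, Bv_one]; simp [ef_zero]
  | succ r ih =>
    intro n
    have h := Bv_e t n r 1
    rw [mul_one, mul_one, Bv_one] at h
    rw [Finset.Nat.antidiagonal_succ, Finset.sum_cons, Finset.sum_map]
    rw [← sub_eq_iff_eq_add] at h
    rw [← h, ih, sub_eq_add_neg, ← Finset.sum_neg_distrib]
    congr 1
    · simp; ring
    · refine Finset.sum_congr rfl fun p _ => ?_
      simp only [Function.Embedding.prodMap, Function.Embedding.coeFn_mk, Prod.map_fst,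
        Prod.map_snd, Function.Embedding.refl_apply]
      rw [show n + Nat.succ p.1 = n + 1 + p.1 by omega, pow_succ]
      ring

theorem Bv_zero_ef (t : F) (r : ℕ) : Bv t 0 (ef F r) = t ^ r • ef F r := by
  rw [Bv_ef, MvPolynomial.smul_eq_C_mul, ef, gco_scale]
  have : ∀ p ∈ Finset.HasAntidiagonal.antidiagonal r,
      ((-1) ^ p.1 * qf t (0 + p.1) * ef F p.2 : Sym F) =
      gco (fun k => (-1) ^ (k + 1) * qcf t k) p.1 * gco ecf p.2 := by
    intro p _
    rw [← gco_scale, zero_add, qf, ef]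
    simp
  rw [Finset.sum_congr rfl this, gco_mul]
  congr 1
  funext k
  simp only [qcf, ecf]
  ring

theorem Bv_one_ef (t : F) (r : ℕ) : Bv t 1 (ef F r) = (1 - t ^ (r + 1)) • ef F (r + 1) := by
  have h := Bv_e t 0 r 1
  rw [mul_one, mul_one, Bv_one, qf_zero, mul_one, Bv_zero_ef] at h
  rw [sub_smul, one_smul]
  exact eq_sub_of_add_eq' h.symm

theorem Bv_pow_one (t : F) (ht : ∀ n : ℕ, 0 < n → t ^ n ≠ 1) (r : ℕ) :
    ∃ x : F, ef F r = x • ((Bv t 1) ^ r) 1 := by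
  induction r with
  | zero => exact ⟨1, by simp [ef_zero]⟩
  | succ r ih =>
    obtain ⟨x, hx⟩ := ih
    have h1 : (1 - t ^ (r + 1)) ≠ 0 :=
      fun h => ht (r + 1) (by omega) (sub_eq_zero.1 h).symm
    refine ⟨(1 - t ^ (r + 1))⁻¹ * x, ?_⟩
    have h := Bv_one_ef t r
    rw [pow_succ' (Bv t 1), Module.End.mul_apply, mul_smul, ← map_smul, ← hx, h, smul_smul,
      inv_mul_cancel₀ h1, one_smul]

end Vertex

section SeqMod

variable {F : Type*} [Field F]

/-- the shift on sequences -/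
def sg : Module.End F (ℕ → Sym F) where
  toFun := fun x r => Nat.casesOn r 0 (fun r => x r)
  map_add' := by
    intro x y; funext r; cases r <;> simp
  map_smul' := by
    intro a x; funext r; cases r <;> simp

/-- pointwise action on sequences -/
def hat (A : Module.End F (Sym F)) : Module.End F (ℕ → Sym F) where
  toFun := fun x r => A (x r)
  map_add' := by intro x y; funext r; simp
  map_smul' := by intro a x; funext r; simp

/-- the sequence concentrated at `0` -/
def dl (f : Sym F) : ℕ → Sym F := fun r => if r = 0 then f else 0

theorem sg_zero (x : ℕ → Sym F) : sg (F := F) x 0 = 0 := rfl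
theorem sg_succ (x : ℕ → Sym F) (r : ℕ) : sg (F := F) x (r + 1) = x r := rfl

theorem hat_apply (A : Module.End F (Sym F)) (x : ℕ → Sym F) (r : ℕ) : hat A x r = A (x r) := rfl

theorem hat_mul (A B : Module.End F (Sym F)) : hat (A * B) = hat A * hat B := rfl

theorem hat_pow (A : Module.End F (Sym F)) (m : ℕ) : hat (A ^ m) = hat A ^ m := by
  induction m with
  | zero => rfl
  | succ m ih => rw [pow_succ, pow_succ, hat_mul, ih]

theorem hat_smul (a : F) (A : Module.End F (Sym F)) : hat (a • A) = a • hat A := rfl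

theorem hat_sg (A : Module.End F (Sym F)) : hat A * sg = sg * hat A := by
  apply LinearMap.ext
  intro x
  funext r
  cases r with
  | zero => simp [hat_apply, sg_zero]
  | succ r => rfl

theorem hat_dl (A : Module.End F (Sym F)) (f : Sym F) : hat A (dl f) = dl (A f) := by
  funext r
  rw [hat_apply, dl, dl]
  split_ifs <;> simp

theorem sg_pow (k : ℕ) : ∀ (x : ℕ → Sym F) (r : ℕ),
    ((sg : Module.End F (ℕ → Sym F)) ^ k) x r = if k ≤ r then x (r - k) else 0 := by
  induction k with
  | zero => intro x r; simp
  | succ k ih =>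
    intro x r
    rw [pow_succ, Module.End.mul_apply, ih]
    by_cases h : k + 1 ≤ r
    · rw [if_pos (by omega), if_pos h, show r - k = r - (k + 1) + 1 by omega, sg_succ]
    · rw [if_neg h]
      split_ifs with h2
      · rw [show r - k = 0 by omega, sg_zero]
      · rfl

theorem sg_pow_dl (k : ℕ) (f : Sym F) (r : ℕ) :
    ((sg : Module.End F (ℕ → Sym F)) ^ k) (dl f) r = if r = k then f else 0 := by
  rw [sg_pow, dl]
  split_ifs <;> first | rfl | omega

variable [CharZero F]

/-- sequence of shifted coefficients -/
def Rhat (t : F) (f : Sym F) : ℕ → Sym F := fun r => shc (cR t) r f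
/-- sequence of products with `e_r` -/
def Ehat (f : Sym F) : ℕ → Sym F := fun r => ef F r * f

theorem Rhat_Bv (t : F) (ht : ∀ n : ℕ, 0 < n → t ^ n ≠ 1) (n : ℕ) (f : Sym F) :
    Rhat t (Bv t (n + 1) f) = (hat (Bv t (n + 1)) + sg * hat (Bv t n) : Module.End F (ℕ → Sym F)) (Rhat t f) := by
  funext r
  rw [LinearMap.add_apply, Pi.add_apply, Module.End.mul_apply]
  cases r with
  | zero => rw [hat_apply, sg_zero, add_zero, Rhat, Rhat, shc_id, shc_id]
  | succ r => rw [sg_succ, hat_apply, hat_apply]; exact shc_Bv t ht r n f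

theorem Ehat_Bv (t : F) (n : ℕ) (f : Sym F) :
    Ehat (Bv t n f) = (sg * hat (Bv t (n + 1)) + hat (Bv t n) : Module.End F (ℕ → Sym F)) (Ehat f) := by
  funext r
  rw [LinearMap.add_apply, Pi.add_apply, Module.End.mul_apply]
  cases r with
  | zero => rw [hat_apply, sg_zero, zero_add, Ehat, Ehat, ef_zero, one_mul, one_mul]
  | succ r =>
    rw [sg_succ, hat_apply, hat_apply]
    rw [Ehat, Ehat, Ehat, Bv_e, add_comm]

theorem Bv_comm_mul (t : F) (n : ℕ) : Bv t n * Bv t (n + 1) = t • (Bv t (n + 1) * Bv t n) :=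
  LinearMap.ext fun f => Bv_rel t n f

theorem Rhat_pow (t : F) (ht : ∀ n : ℕ, 0 < n → t ^ n ≠ 1) (n m : ℕ) (f : Sym F) :
    Rhat t ((Bv t (n + 1) ^ m) f) = ∑ k ∈ Finset.range (m + 1), qbinom t (m : ℤ) (k : ℤ) •
      (sg ^ k) (hat (Bv t (n + 1) ^ (m - k) * Bv t n ^ k) (Rhat t f)) := by
  have h1 : Rhat t ((Bv t (n + 1) ^ m) f) =
      ((hat (Bv t (n + 1)) + sg * hat (Bv t n)) ^ m : Module.End F (ℕ → Sym F)) (Rhat t f) := by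
    induction m with
    | zero => rfl
    | succ m ih =>
      rw [pow_succ' (Bv t (n + 1)), Module.End.mul_apply, Rhat_Bv t ht, ih, pow_succ',
        Module.End.mul_apply]
  rw [h1, qbinom_thm t ht, LinearMap.sum_apply]
  · refine Finset.sum_congr rfl fun k _ => ?_
    rw [LinearMap.smul_apply]
    congr 1
    have hc : Commute (sg : Module.End F (ℕ → Sym F)) (hat (Bv t n)) := (hat_sg _).symm
    have hc2 : Commute (sg : Module.End F (ℕ → Sym F)) (hat (Bv t (n + 1))) := (hat_sg _).symm
    rw [hc.mul_pow, ← mul_assoc, ← (hc2.pow_pow k (m - k)).eq, mul_assoc, hat_mul, hat_pow,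
      hat_pow, Module.End.mul_apply]
  · rw [mul_assoc, ← hat_mul, Bv_comm_mul, hat_smul, hat_mul, mul_smul_comm, ← mul_assoc,
      ← mul_assoc, hat_sg]

theorem Ehat_pow (t : F) (ht : ∀ n : ℕ, 0 < n → t ^ n ≠ 1) (n m : ℕ) (f : Sym F) :
    Ehat ((Bv t n ^ m) f) = ∑ k ∈ Finset.range (m + 1), qbinom t (m : ℤ) (k : ℤ) •
      (sg ^ (m - k)) (hat (Bv t (n + 1) ^ (m - k) * Bv t n ^ k) (Ehat f)) := by
  have h1 : Ehat ((Bv t n ^ m) f) =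
      ((sg * hat (Bv t (n + 1)) + hat (Bv t n)) ^ m : Module.End F (ℕ → Sym F)) (Ehat f) := by
    induction m with
    | zero => rfl
    | succ m ih =>
      rw [pow_succ' (Bv t n), Module.End.mul_apply, Ehat_Bv t, ih, pow_succ',
        Module.End.mul_apply]
  rw [h1, qbinom_thm t ht, LinearMap.sum_apply]
  · refine Finset.sum_congr rfl fun k _ => ?_
    rw [LinearMap.smul_apply]
    congr 1
    have hc2 : Commute (sg : Module.End F (ℕ → Sym F)) (hat (Bv t (n + 1))) := (hat_sg _).symm
    rw [hc2.mul_pow, mul_assoc, hat_mul, hat_pow,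
      hat_pow, Module.End.mul_apply]
  · rw [← mul_assoc, hat_sg, mul_assoc, ← hat_mul, Bv_comm_mul, hat_smul, hat_mul, mul_smul_comm,
      ← mul_assoc]

/-- iterated vertex operators -/
def Wv (t : F) : ℕ → (ℕ → ℕ) → Sym F
  | 0, _ => 1
  | N + 1, c => (Bv t (N + 1) ^ (c N - c (N + 1))) (Wv t N c)

theorem Wv_congr (t : F) (N : ℕ) (c d : ℕ → ℕ) (h : ∀ i, i ≤ N → c i = d i) :
    Wv t N c = Wv t N d := by
  induction N with
  | zero => rfl
  | succ N ih =>
    rw [Wv, Wv, ih (fun i hi => h i (by omega)), h N (by omega), h (N + 1) (by omega)]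

theorem Bv_zero_pow_one (t : F) (k : ℕ) : (Bv t 0 ^ k) (1 : Sym F) = 1 := by
  induction k with
  | zero => rfl
  | succ k ih => rw [pow_succ', Module.End.mul_apply, ih, Bv_one, qf_zero]

theorem Wv_update (t : F) (N : ℕ) (n : ℕ → ℕ) (x : ℕ) (hx : x ≤ n N)
    (hn : ∀ M, N = M + 1 → n N ≤ n M) :
    Wv t N (Function.update n N x) = (Bv t N ^ (n N - x)) (Wv t N n) := by
  cases N with
  | zero => rw [Wv, Wv, Bv_zero_pow_one]
  | succ M =>
    have h1 := hn M rfl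
    rw [Wv, Wv, ← Module.End.mul_apply, ← pow_add]
    rw [Wv_congr t M (Function.update n (M + 1) x) n (fun i hi => by
      rw [Function.update_of_ne (by omega)])]
    rw [Function.update_self, Function.update_of_ne (by omega)]
    congr 2
    omega

theorem Wv_stab (t : F) (N : ℕ) (c : ℕ → ℕ) (h : c N = c (N + 1)) :
    Wv t (N + 1) c = Wv t N c := by
  rw [Wv, h, Nat.sub_self]; rfl

open Classical in
/-- vertical strip removals -/
def Box : ℕ → (ℕ → ℕ) → Finset (ℕ → ℕ)
  | 0, c => {c}
  | N + 1, c => ((Box N c) ×ˢ (Finset.Icc (c (N + 1)) (c N))).image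
      fun p => Function.update p.1 N p.2

theorem mem_Box (N : ℕ) (c n : ℕ → ℕ) : n ∈ Box N c ↔
    (∀ i, N ≤ i → n i = c i) ∧ ∀ i, i < N → c (i + 1) ≤ n i ∧ n i ≤ c i := by
  classical
  induction N generalizing n with
  | zero =>
    rw [Box, Finset.mem_singleton]
    constructor
    · rintro rfl; simp
    · intro h; funext i; exact h.1 i (by omega)
  | succ N ih =>
    rw [Box]
    simp only [Finset.mem_image, Finset.mem_product, Finset.mem_Icc, Prod.exists]
    constructor
    · rintro ⟨m, x, ⟨hm, hx⟩, rfl⟩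
      rw [ih] at hm
      constructor
      · intro i hi
        rw [Function.update_of_ne (by omega)]
        exact hm.1 i (by omega)
      · intro i hi
        by_cases h : i = N
        · subst h; rw [Function.update_self]; exact hx
        · rw [Function.update_of_ne h]; exact hm.2 i (by omega)
    · intro h
      refine ⟨Function.update n N (c N), n N, ⟨(ih _).2 ⟨?_, ?_⟩, h.2 N (by omega)⟩, ?_⟩
      · intro i hi
        by_cases hh : i = N
        · subst hh; rw [Function.update_self]
        · rw [Function.update_of_ne hh]; exact h.1 i (by omega)
      · intro i hi
        rw [Function.update_of_ne (by omega)]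
        exact h.2 i (by omega)
      · simp

theorem sum_Box {M : Type*} [AddCommMonoid M] (N : ℕ) (c : ℕ → ℕ) (f : (ℕ → ℕ) → M) :
    ∑ n ∈ Box (N + 1) c, f n =
      ∑ n ∈ Box N c, ∑ x ∈ Finset.Icc (c (N + 1)) (c N), f (Function.update n N x) := by
  classical
  rw [Box, Finset.sum_image, Finset.sum_product]
  rintro ⟨a, x⟩ ha ⟨b, y⟩ hb hab
  simp only [Finset.coe_product, Set.mem_prod, Finset.mem_coe] at ha hb
  simp only at hab
  have hx : x = y := by
    have := congrFun hab N
    simpa using this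
  have hab2 : a = b := by
    funext i
    by_cases h : i = N
    · subst h
      rw [((mem_Box _ _ _).1 ha.1).1 i le_rfl, ((mem_Box _ _ _).1 hb.1).1 i le_rfl]
    · have := congrFun hab i
      rwa [Function.update_of_ne h, Function.update_of_ne h] at this
  rw [hx, hab2]

theorem prod_Box {M : Type*} [CommRing M] (N : ℕ) (c : ℕ → ℕ) (f : ℕ → ℕ → M) :
    ∑ n ∈ Box N c, ∏ i ∈ Finset.range N, f i (n i) =
      ∏ i ∈ Finset.range N, ∑ x ∈ Finset.Icc (c (i + 1)) (c i), f i x := by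
  induction N with
  | zero => simp [Box]
  | succ N ih =>
    rw [sum_Box, Finset.prod_range_succ, ← ih, Finset.sum_mul]
    refine Finset.sum_congr rfl fun n _ => ?_
    rw [Finset.mul_sum]
    refine Finset.sum_congr rfl fun x _ => ?_
    rw [Finset.prod_range_succ, Function.update_self]
    congr 1
    refine Finset.prod_congr rfl fun i hi => ?_
    rw [Finset.mem_range] at hi
    rw [Function.update_of_ne (by omega)]

theorem Rex (t : F) (ht : ∀ n : ℕ, 0 < n → t ^ n ≠ 1) (N : ℕ) (c : ℕ → ℕ)
    (hc : ∀ i, c (i + 1) ≤ c i) :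
    Rhat t (Wv t N c) = ∑ n ∈ Box N c,
      (∏ i ∈ Finset.range N, qbinom t ((c i : ℤ) - c (i + 1)) ((c i : ℤ) - n i)) •
        (sg ^ (∑ i ∈ Finset.range N, (c i - n i))) (dl (Wv t N n)) := by
  induction N with
  | zero =>
    rw [Box, Finset.sum_singleton]
    funext r
    simp only [Rhat, Wv, shc_one]
    simp [dl]
  | succ N ih =>
    rw [Wv, Rhat_pow t ht, ih, sum_Box]
    simp only [map_sum, Finset.smul_sum]
    rw [Finset.sum_comm]
    refine Finset.sum_congr rfl fun n hn => ?_
    rw [mem_Box] at hn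
    symm
    refine Finset.sum_nbij' (fun x => c N - x) (fun k => c N - k) ?_ ?_ ?_ ?_ ?_
    · intro x hx
      rw [Finset.mem_Icc] at hx
      rw [Finset.mem_range]
      omega
    · intro k hk
      rw [Finset.mem_range] at hk
      have := hc N
      rw [Finset.mem_Icc]
      omega
    · intro x hx
      rw [Finset.mem_Icc] at hx
      omega
    · intro k hk
      rw [Finset.mem_range] at hk
      have := hc N
      omega
    · intro x hx
      rw [Finset.mem_Icc] at hx
      have hcN := hc N
      rw [Finset.prod_range_succ, Finset.sum_range_succ, Function.update_self, map_smul, map_smul,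
        smul_smul, mul_comm]
      have hn0 : ∀ i ∈ Finset.range N, Function.update n N x i = n i := by
        intro i hi
        rw [Finset.mem_range] at hi
        rw [Function.update_of_ne (by omega)]
      congr 1
      · congr 1
        · rw [Nat.cast_sub hcN, Nat.cast_sub hx.2]
        · exact Finset.prod_congr rfl fun i hi => by rw [hn0 i hi]
      · rw [Finset.sum_congr rfl (fun i hi => by rw [hn0 i hi] :
          ∀ i ∈ Finset.range N, c i - Function.update n N x i = c i - n i)]
        have hcm : ∀ (A : Module.End F (Sym F)) (k : ℕ) (y : ℕ → Sym F),
            hat A (((sg : Module.End F (ℕ → Sym F)) ^ k) y) = (sg ^ k) (hat A y) := by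
          intro A k y
          have hc2 : Commute (hat A) (sg : Module.End F (ℕ → Sym F)) := hat_sg _
          have := (hc2.pow_right k).eq
          exact congrArg (fun G => G y) this
        rw [hcm, ← Module.End.mul_apply, ← pow_add, hat_dl, add_comm]
        congr 2
        rw [Wv, Function.update_self, Function.update_of_ne (by omega), hn.1 (N + 1) (by omega),
          Wv_update t N n x (by rw [hn.1 N le_rfl]; exact hx.2), hn.1 N le_rfl,
          Module.End.mul_apply, show c N - c (N + 1) - (c N - x) = x - c (N + 1) by omega]
        intro M hM
        subst hM
        rw [hn.1 (M + 1) le_rfl]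
        exact (hn.2 M (by omega)).1

/-- support condition for multiplication by `e_r` -/
def EQ (N : ℕ) (c : ℕ → ℕ) (r : ℕ) (n : ℕ → ℕ) : Prop :=
  n (N + 1) = c N ∧ (∀ i, i ≤ N → c i ≤ n i ∧ n (i + 1) ≤ c i) ∧
    ∑ i ∈ Finset.range (N + 1), n i = r + ∑ i ∈ Finset.range (N + 1), c i

theorem Esup (t : F) (ht : ∀ n : ℕ, 0 < n → t ^ n ≠ 1) (N : ℕ) (c : ℕ → ℕ)
    (hc : ∀ i, c (i + 1) ≤ c i) : ∀ r, ef F r * Wv t N c ∈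
      Submodule.span F {g | ∃ n, EQ N c r n ∧ g = Wv t (N + 1) n} := by
  induction N with
  | zero =>
    intro r
    obtain ⟨x, hx⟩ := Bv_pow_one t ht r
    rw [Wv, mul_one, hx]
    refine Submodule.smul_mem _ _ (Submodule.subset_span ?_)
    refine ⟨fun i => if i = 0 then c 0 + r else c 0, ⟨by simp, ?_, ?_⟩, ?_⟩
    · intro i hi
      have : i = 0 := by omega
      subst this; simp
    · simp; ring
    · simp [Wv]
  | succ N ih =>
    intro r
    have h1 : ef F r * Wv t (N + 1) c = Ehat (Wv t (N + 1) c) r := rfl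
    rw [h1, Wv, Ehat_pow t ht, Finset.sum_apply]
    refine Submodule.sum_mem _ fun k hk => ?_
    rw [Pi.smul_apply]
    refine Submodule.smul_mem _ _ ?_
    rw [Finset.mem_range] at hk
    have hcN := hc N
    rw [sg_pow]
    split_ifs with hr
    swap
    · exact Submodule.zero_mem _
    rw [hat_apply]
    change _ ∈ _
    have hmem := ih (r - (c N - c (N + 1) - k))
    change Ehat (Wv t N c) (r - (c N - c (N + 1) - k)) ∈ _ at hmem
    have h2 := Submodule.mem_map_of_mem
      (f := (Bv t (N + 1 + 1) ^ (c N - c (N + 1) - k) * Bv t (N + 1) ^ k)) hmem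
    rw [Submodule.map_span] at h2
    refine (Submodule.span_le.2 ?_) h2
    rintro _ ⟨_, ⟨n, hn, rfl⟩, rfl⟩
    refine Submodule.subset_span ?_
    obtain ⟨hn1, hn2, hn3⟩ := hn
    set n' := Function.update (Function.update n (N + 1) (c N - k)) (N + 2) (c (N + 1)) with hn'
    have e1 : n' (N + 2) = c (N + 1) := by rw [hn', Function.update_self]
    have e2 : n' (N + 1) = c N - k := by
      rw [hn', Function.update_of_ne (by omega), Function.update_self]
    have e3 : ∀ i, i ≤ N → n' i = n i := by
      intro i hi
      rw [hn', Function.update_of_ne (by omega), Function.update_of_ne (by omega)]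
    refine ⟨n', ⟨e1, ?_, ?_⟩, ?_⟩
    · intro i hi
      rcases Nat.lt_or_ge i N with h | h
      · rw [e3 i (by omega), e3 (i + 1) (by omega)]
        exact hn2 i (by omega)
      · rcases Nat.eq_or_lt_of_le h with h | h
        · subst h
          rw [e3 _ le_rfl, e2]
          have := hn2 N le_rfl
          omega
        · have : i = N + 1 := by omega
          subst this
          rw [e2, e1]
          omega
    · rw [Finset.sum_range_succ, Finset.sum_range_succ _ (N + 1), e2,
        Finset.sum_congr rfl (fun i hi => e3 i (by rw [Finset.mem_range] at hi; omega)), hn3]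
      omega
    · have e0 : Wv t (N + 1 + 1) n' =
          (Bv t (N + 2) ^ (n' (N + 1) - n' (N + 2))) (Wv t (N + 1) n') := rfl
      rw [e0, e1, e2, Module.End.mul_apply]
      have e4 : Wv t (N + 1) n' = Wv t (N + 1) (Function.update n (N + 1) (c N - k)) := by
        refine Wv_congr t _ _ _ fun i hi => ?_
        rw [hn', Function.update_of_ne (by omega)]
      rw [e4, Wv_update t (N + 1) n (c N - k) (by omega), hn1]
      · rw [show c N - k - c (N + 1) = c N - c (N + 1) - k by omega,
          show c N - (c N - k) = k by omega]
      · intro M hM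
        have : M = N := by omega
        subst this
        rw [hn1]
        exact (hn2 M le_rfl).1

theorem Bv_const (t : F) (n : ℕ) (f : Sym F) : MvPolynomial.constantCoeff (Bv t (n + 1) f) = 0 := by
  obtain ⟨N, hN⟩ := shft_bound (cT : ℕ → F) f
  rw [Bv_apply, Lq_range t _ N _ hN, map_sum]
  refine Finset.sum_eq_zero fun k _ => ?_
  rw [map_mul, qf, gco_const _ _ (by omega), mul_zero]

theorem ip_one (z : ℕ → F) (f : Sym F) : ip z f 1 = MvPolynomial.constantCoeff f := by
  rw [ip_comm]
  have := ip_monomial z 0 1 f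
  rw [show MvPolynomial.monomial (0 : ℕ →₀ ℕ) (1 : F) = 1 from rfl] at this
  rw [this, zw, Finsupp.prod_zero_index, mul_one, one_mul]; rfl

end SeqMod

section SkIdentity

variable {F : Type*} [Field F]

theorem qbinom_symm (t : F) (k j : ℕ) :
    qbinom t ((k + j : ℕ) : ℤ) (k : ℤ) = qbinom t ((k + j : ℕ) : ℤ) (j : ℤ) := by
  rw [qbinom_nat, show k + j = j + k by omega, qbinom_nat, mul_comm (qfac t k)]

variable [CharZero F]

theorem qbinom_pascal2 (t : F) (ht : ∀ n : ℕ, 0 < n → t ^ n ≠ 1) (m k : ℕ) :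
    qbinom t ((m + 1 : ℕ) : ℤ) ((k + 1 : ℕ) : ℤ) =
      qbinom t (m : ℤ) (k : ℤ) + t ^ (k + 1) * qbinom t (m : ℤ) ((k + 1 : ℕ) : ℤ) := by
  rcases Nat.lt_trichotomy k m with h | h | h
  · obtain ⟨l, rfl⟩ : ∃ l, m = k + 1 + l := ⟨m - (k + 1), by omega⟩
    have h1 := qbinom_symm t (k + 1) (l + 1)
    have h2 := qbinom_pascal t ht (k + 1 + l) l (by omega)
    have h3 := qbinom_symm t (k + 1) l
    have h4 := qbinom_symm t k (l + 1)
    rw [show k + 1 + l + 1 = k + 1 + (l + 1) by omega, h1] 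
    rw [show k + 1 + l + 1 = k + 1 + (l + 1) by omega] at h2
    rw [h2, h3, show k + 1 + l = k + (l + 1) by omega, h4, show k + (l + 1) - l = k + 1 by omega]
  · subst h
    rw [qbinom_self t ht, qbinom_self t ht, qbinom_gt _ _ _ (by omega)]; ring
  · rw [qbinom_gt _ _ _ (by omega), qbinom_gt _ _ _ (by omega), qbinom_gt _ _ _ (by omega)]; ring

theorem alt_tel (t : F) (ht : ∀ n : ℕ, 0 < n → t ^ n ≠ 1) (m K : ℕ) :
    ∑ k ∈ Finset.range (K + 1), (-1 : F) ^ k * t ^ (k.choose 2) *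
      qbinom t ((m + 1 : ℕ) : ℤ) (k : ℤ) =
    (-1 : F) ^ K * t ^ ((K + 1).choose 2) * qbinom t (m : ℤ) (K : ℤ) := by
  induction K with
  | zero =>
    have h1 := qbinom_zero t ht m
    have h2 := qbinom_zero t ht (m + 1)
    simp only [zero_add, Finset.sum_range_one, Nat.cast_zero, h1, h2]
    simp
  | succ K ih =>
    rw [Finset.sum_range_succ, ih, qbinom_pascal2 t ht]
    have : (K + 1 + 1).choose 2 = (K + 1).choose 2 + (K + 1) := by
      rw [Nat.choose_succ_succ' (K + 1) 1, Nat.choose_one_right]; exact add_comm _ _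
    rw [this]
    ring

theorem alt_sum (t : F) (ht : ∀ n : ℕ, 0 < n → t ^ n ≠ 1) (m : ℕ) :
    ∑ k ∈ Finset.range (m + 2), (-1 : F) ^ k * t ^ (k.choose 2) *
      qbinom t ((m + 1 : ℕ) : ℤ) (k : ℤ) = 0 := by
  rw [alt_tel t ht, qbinom_gt _ _ _ (by omega), mul_zero]

/-- one factor of the inversion identity -/
def gfac (t : F) (L m m' n : ℕ) : F :=
  qbinom t ((L : ℤ) - m') ((L : ℤ) - n) * (-1) ^ (L - n) *
    (t ^ ((n - m).choose 2) * qbinom t ((n : ℤ) - m') ((n : ℤ) - m))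

theorem gsum (t : F) (ht : ∀ n : ℕ, 0 < n → t ^ n ≠ 1) (L m m' : ℕ) (h1 : m' ≤ m) :
    ∑ n ∈ Finset.Icc m' L, gfac t L m m' n = if L = m then 1 else 0 := by
  have hz : ∀ n, n < m → gfac t L m m' n = 0 := by
    intro n hn
    rw [gfac, qbinom_neg t ((n : ℤ) - m') _ (by omega)]; ring
  rcases Nat.lt_or_ge L m with h | h
  · rw [if_neg (by omega)]
    refine Finset.sum_eq_zero fun n hn => hz n ?_
    rw [Finset.mem_Icc] at hn; omega
  obtain ⟨N, rfl⟩ : ∃ N, L = m + N := ⟨L - m, by omega⟩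
  obtain ⟨b, rfl⟩ : ∃ b, m = m' + b := ⟨m - m', by omega⟩
  have e1 : ∑ n ∈ Finset.Icc m' (m' + b + N), gfac t (m' + b + N) (m' + b) m' n =
      ∑ k ∈ Finset.range (N + 1), gfac t (m' + b + N) (m' + b) m' (m' + b + k) := by
    rw [← Finset.sum_subset (s₁ := Finset.Ico (m' + b) (m' + b + (N + 1)))]
    · rw [Finset.sum_Ico_eq_sum_range]
      simp
    · intro n hn
      rw [Finset.mem_Ico] at hn
      rw [Finset.mem_Icc]; omega
    · intro n hn hn2
      rw [Finset.mem_Ico] at hn2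
      rw [Finset.mem_Icc] at hn
      exact hz n (by omega)
  rw [e1]
  have e2 : ∀ k ∈ Finset.range (N + 1), gfac t (m' + b + N) (m' + b) m' (m' + b + k) =
      qbinom t ((b + N : ℕ) : ℤ) (b : ℤ) * (-1) ^ N * ((-1 : F) ^ k * t ^ (k.choose 2) *
        qbinom t (N : ℤ) (k : ℤ)) := by
    intro k hk
    rw [Finset.mem_range] at hk
    obtain ⟨j, rfl⟩ : ∃ j, N = k + j := ⟨N - k, by omega⟩
    rw [gfac]
    rw [show ((m' + b + (k + j) : ℕ) : ℤ) - m' = ((j + (b + k) : ℕ) : ℤ) by push_cast; ring,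
      show ((m' + b + (k + j) : ℕ) : ℤ) - ((m' + b + k : ℕ) : ℤ) = (j : ℤ) by push_cast; ring,
      show ((m' + b + k : ℕ) : ℤ) - m' = ((k + b : ℕ) : ℤ) by push_cast; ring,
      show ((m' + b + k : ℕ) : ℤ) - ((m' + b : ℕ) : ℤ) = (k : ℤ) by push_cast; ring,
      show m' + b + (k + j) - (m' + b + k) = j by omega,
      show m' + b + k - (m' + b) = k by omega, qbinom_nat, qbinom_nat, qbinom_nat, qbinom_nat]
    rw [show j + (b + k) = b + (k + j) by omega, show k + b = b + k by omega]
    have a1 := qfac_ne_zero t ht j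
    have a2 := qfac_ne_zero t ht k
    have a3 := qfac_ne_zero t ht b
    have a4 := qfac_ne_zero t ht (b + k)
    have a5 := qfac_ne_zero t ht (k + j)
    have a6 : (-1 : F) ^ (k + j) * (-1) ^ k = (-1) ^ j := by
      rw [← pow_add, show k + j + k = 2 * k + j by omega, pow_add, pow_mul]; simp
    rw [← a6]
    field_simp
  rw [Finset.sum_congr rfl e2, ← Finset.mul_sum]
  cases N with
  | zero =>
    rw [if_pos (by omega)]
    have := qbinom_self t ht b
    have h3 := qbinom_zero t ht 0
    simp [this]
    exact_mod_cast h3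
  | succ N => rw [alt_sum t ht, mul_zero, if_neg (by omega)]

open Classical in
theorem inv_id (t : F) (ht : ∀ n : ℕ, 0 < n → t ^ n ≠ 1) (N : ℕ) (c m : ℕ → ℕ)
    (hm : ∀ i, m (i + 1) ≤ m i) (hc0 : ∀ i, N ≤ i → c i = 0) (hm0 : ∀ i, N ≤ i → m i = 0) :
    ∑ n ∈ Box N c,
      (∏ i ∈ Finset.range N, qbinom t ((c i : ℤ) - c (i + 1)) ((c i : ℤ) - n i)) *
        (-1) ^ (∑ i ∈ Finset.range N, (c i - n i)) *
        ∏ i ∈ Finset.range N, (t ^ ((n i - m i).choose 2) *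
          qbinom t ((n i : ℤ) - m (i + 1)) ((n i : ℤ) - m i)) =
      if c = m then 1 else 0 := by
  have e : ∀ n ∈ Box N c, (∏ i ∈ Finset.range N, qbinom t ((c i : ℤ) - c (i + 1)) ((c i : ℤ) - n i)) *
        (-1) ^ (∑ i ∈ Finset.range N, (c i - n i)) *
        ∏ i ∈ Finset.range N, (t ^ ((n i - m i).choose 2) *
          qbinom t ((n i : ℤ) - m (i + 1)) ((n i : ℤ) - m i)) =
      ∏ i ∈ Finset.range N, (qbinom t ((c i : ℤ) - c (i + 1)) ((c i : ℤ) - n i) * (-1) ^ (c i - n i) *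
       (t ^ ((n i - m i).choose 2) * qbinom t ((n i : ℤ) - m (i + 1)) ((n i : ℤ) - m i))) := by
    intro n _
    rw [← Finset.prod_pow_eq_pow_sum, ← Finset.prod_mul_distrib, ← Finset.prod_mul_distrib]
  rw [Finset.sum_congr rfl e, prod_Box N c (fun i x =>
    (qbinom t ((c i : ℤ) - c (i + 1)) ((c i : ℤ) - x) * (-1) ^ (c i - x) *
       (t ^ ((x - m i).choose 2) * qbinom t ((x : ℤ) - m (i + 1)) ((x : ℤ) - m i))))]
  have key : ∀ i, c (i + 1) = m (i + 1) → ∑ x ∈ Finset.Icc (c (i + 1)) (c i),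
      (qbinom t ((c i : ℤ) - c (i + 1)) ((c i : ℤ) - x) * (-1) ^ (c i - x) *
       (t ^ ((x - m i).choose 2) * qbinom t ((x : ℤ) - m (i + 1)) ((x : ℤ) - m i))) =
       if c i = m i then 1 else 0 := by
    intro i hi
    rw [hi, ← gsum t ht (c i) (m i) (m (i + 1)) (hm i)]
    rfl
  split_ifs with h
  · refine Finset.prod_eq_one fun i _ => ?_
    rw [key i (by rw [h]), if_pos (by rw [h])]
  · have : ∃ i, c i ≠ m i ∧ ∀ j, i < j → c j = m j := by
      by_contra hcon
      push Not at hcon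
      have h4 : ∀ k i, c i ≠ m i → ∃ j, i + k ≤ j ∧ c j ≠ m j := by
        intro k
        induction k with
        | zero => intro i hi; exact ⟨i, by omega, hi⟩
        | succ k ih =>
          intro i hi
          obtain ⟨j, h1, h2⟩ := ih i hi
          obtain ⟨l, h3, h4⟩ := hcon j h2
          exact ⟨l, by omega, h4⟩
      apply h
      funext i
      by_contra hi
      obtain ⟨j, h1, h2⟩ := h4 N i hi
      exact h2 (by rw [hc0 j (by omega), hm0 j (by omega)])
    obtain ⟨i, hi1, hi2⟩ := this
    have hiN : i < N := by
      by_contra hcon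
      exact hi1 (by rw [hc0 i (by omega), hm0 i (by omega)])
    refine Finset.prod_eq_zero (Finset.mem_range.2 hiN) ?_
    rw [key i (hi2 _ (by omega)), if_neg hi1]

theorem skHL_eq (t : F) (ht : ∀ n : ℕ, 0 < n → t ^ n ≠ 1) (lam mu : Partition) (N : ℕ)
    (h1 : lam.part 0 ≤ N) (h2 : mu.part 0 ≤ N) :
    skHL t lam mu = ∏ i ∈ Finset.range N, (t ^ ((cj lam i - cj mu i).choose 2) *
          qbinom t ((cj lam i : ℤ) - cj mu (i + 1)) ((cj lam i : ℤ) - cj mu i)) := by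
  have hk : skHL t lam mu = t ^ nskew lam mu * ∏ i ∈ Finset.range (lam.part 0 + mu.part 0),
      qbinom t ((cj lam i : ℤ) - cj mu (i + 1)) ((cj lam i : ℤ) - cj mu i) := by
    rw [skHL, ← Finset.Ico_add_one_right_eq_Icc, Finset.prod_Ico_eq_prod_range]
    congr 1
    refine Finset.prod_congr (by simp) fun i _ => ?_
    rw [cj, cj, cj, add_comm 1 i]
  rw [hk, nskew, ← Finset.Ico_add_one_right_eq_Icc, Finset.sum_Ico_eq_sum_range,
    ← Finset.prod_pow_eq_pow_sum, Nat.add_sub_cancel, ← Finset.prod_mul_distrib]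
  have e : ∀ i, lam.part 0 ≤ i → mu.part 0 ≤ i → (t ^ ((cj lam i - cj mu i).choose 2) *
          qbinom t ((cj lam i : ℤ) - cj mu (i + 1)) ((cj lam i : ℤ) - cj mu i)) = 1 := by
    intro i h3 h4
    rw [cj_zero lam h3, cj_zero mu h4, cj_zero mu (by omega)]
    have := qbinom_zero t ht 0
    simpa using this
  have e2 : ∀ M, lam.part 0 ≤ M → mu.part 0 ≤ M →
      ∏ i ∈ Finset.range M, (t ^ ((cj lam i - cj mu i).choose 2) *
          qbinom t ((cj lam i : ℤ) - cj mu (i + 1)) ((cj lam i : ℤ) - cj mu i)) =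
      ∏ i ∈ Finset.range (max (lam.part 0) (mu.part 0)), (t ^ ((cj lam i - cj mu i).choose 2) *
          qbinom t ((cj lam i : ℤ) - cj mu (i + 1)) ((cj lam i : ℤ) - cj mu i)) := by
    intro M h3 h4
    symm
    refine Finset.prod_subset ?_ ?_
    · intro i hi; rw [Finset.mem_range] at *; omega
    · intro i hi hi2
      rw [Finset.mem_range] at *
      exact e i (by omega) (by omega)
  rw [e2 N h1 h2, ← e2 (lam.part 0 + mu.part 0) (by omega) (by omega)]
  refine Finset.prod_congr rfl fun i _ => ?_
  rw [cj, cj, cj, add_comm 1 i]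

end SkIdentity

section Pairings

variable {F : Type*} [Field F] [CharZero F]

/-- weights of the Hall product -/
def hz (F : Type*) [Field F] : ℕ → F := fun n => (n : F) + 1
/-- weights of the `t`-product -/
def tz (t : F) : ℕ → F := fun n => ((n : F) + 1) * ((1 - 0 ^ (n + 1)) / (1 - t ^ (n + 1)))

theorem inner_tz (t : F) (f g : Sym F) : innerQT 0 t f g = ip (tz t) f g := innerQT_eq 0 t f g

theorem inner_hz (t : F) (ht : ∀ n : ℕ, 0 < n → t ^ n ≠ 1) (f g : Sym F) :
    innerQT t t f g = ip (hz F) f g := by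
  rw [innerQT_eq]
  congr 1
  funext n
  rw [div_self, mul_one, hz]
  exact fun h => ht (n + 1) (by omega) (sub_eq_zero.1 h).symm

theorem hz_ne (n : ℕ) : hz F n ≠ 0 := by
  rw [hz]; exact_mod_cast Nat.succ_ne_zero n

theorem tz_ne (t : F) (ht : ∀ n : ℕ, 0 < n → t ^ n ≠ 1) (n : ℕ) : tz t n ≠ 0 := by
  rw [tz]
  refine mul_ne_zero (hz_ne n) (div_ne_zero ?_ ?_)
  · simp
  · exact fun h => ht (n + 1) (by omega) (sub_eq_zero.1 h).symm

/-- products of elementary functions -/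
def Ep (F : Type*) [Field F] (N : ℕ) (a : ℕ → ℕ) : Sym F := ∏ i ∈ Finset.range N, ef F (a i)

/-- products of complete functions -/
def Hp (F : Type*) [Field F] (K : ℕ) (d : ℕ → ℕ) : Sym F :=
  ∏ j ∈ Finset.range K, gco (fun _ => (1 : F)) (d j)

theorem Ep_succ' (N : ℕ) (a : ℕ → ℕ) :
    Ep F (N + 1) a = ef F (a 0) * Ep F N (fun i => a (i + 1)) := by
  rw [Ep, Finset.prod_range_succ', mul_comm]; rfl

theorem Ep_succ (N : ℕ) (a : ℕ → ℕ) : Ep F (N + 1) a = ef F (a N) * Ep F N a := by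
  rw [Ep, Finset.prod_range_succ, mul_comm]; rfl

theorem Hp_succ' (N : ℕ) (a : ℕ → ℕ) :
    Hp F (N + 1) a = gco (fun _ => (1 : F)) (a 0) * Hp F N (fun i => a (i + 1)) := by
  rw [Hp, Finset.prod_range_succ', mul_comm]; rfl

theorem ip_t_e (t : F) (f g : Sym F) (r : ℕ) :
    ip (tz t) f (ef F r * g) = ip (tz t) (shc (cR t) r f) g := by
  refine ip_gco (tz t) ecf (cR t) ?_ f r g
  intro k
  have := hz_ne (F := F) k
  rw [hz] at this
  rw [cR, ecf, tz]
  field_simp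
  simp

theorem ip_h_h (f g : Sym F) (r : ℕ) :
    ip (hz F) f (gco (fun _ => (1 : F)) r * g) = ip (hz F) (shc (fun _ => 1) r f) g := by
  refine ip_gco (hz F) _ _ ?_ f r g
  intro k
  have := hz_ne (F := F) k
  rw [one_mul, hz] at *
  rw [div_self this]

theorem shcR_W (t : F) (ht : ∀ n : ℕ, 0 < n → t ^ n ≠ 1) (N : ℕ) (c : ℕ → ℕ)
    (hc : ∀ i, c (i + 1) ≤ c i) (r : ℕ) :
    shc (cR t) r (Wv t N c) = ∑ n ∈ Box N c,
      (∏ i ∈ Finset.range N, qbinom t ((c i : ℤ) - c (i + 1)) ((c i : ℤ) - n i)) •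
        (if r = ∑ i ∈ Finset.range N, (c i - n i) then Wv t N n else 0) := by
  have := congrFun (Rex t ht N c hc) r
  rw [Finset.sum_apply] at this
  rw [Rhat] at this
  rw [this]
  refine Finset.sum_congr rfl fun n _ => ?_
  rw [Pi.smul_apply, sg_pow_dl]

theorem Wv_cc (t : F) (N : ℕ) (c : ℕ → ℕ) (hc : ∀ i, c (i + 1) ≤ c i)
    (h : MvPolynomial.constantCoeff (Wv t N c) ≠ 0) : ∀ i, i ≤ N → c i = c N := by
  induction N with
  | zero => intro i hi; rw [show i = 0 by omega]
  | succ N ih =>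
    have h2 : c N - c (N + 1) = 0 := by
      by_contra hcon
      obtain ⟨k, hk⟩ := Nat.exists_eq_succ_of_ne_zero hcon
      rw [Wv, hk, Nat.succ_eq_add_one, pow_succ', Module.End.mul_apply, Bv_const] at h
      exact h rfl
    have h3 : c N = c (N + 1) := by have := hc N; omega
    rw [Wv_stab t N c h3] at h
    intro i hi
    rcases Nat.lt_or_ge N i with h4 | h4
    · rw [show i = N + 1 by omega]
    · rw [ih h i h4, h3]

theorem Wv_zero (t : F) (N : ℕ) (c : ℕ → ℕ) (h : ∀ i, c i = 0) : Wv t N c = 1 := by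
  induction N with
  | zero => rfl
  | succ N ih => rw [Wv_stab t N c (by rw [h, h]), ih]

/-- sequences that are conjugates of partitions with parts at most `N` -/
def Ad (N : ℕ) (c : ℕ → ℕ) : Prop := (∀ i, c (i + 1) ≤ c i) ∧ ∀ i, N ≤ i → c i = 0

theorem Box_Ad (N : ℕ) (c n : ℕ → ℕ) (hc : Ad N c) (hn : n ∈ Box N c) : Ad N n := by
  rw [mem_Box] at hn
  refine ⟨fun i => ?_, fun i hi => by rw [hn.1 i hi, hc.2 i hi]⟩
  rcases Nat.lt_or_ge i N with h | h
  · have h1 := hn.2 i h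
    rcases Nat.lt_or_ge (i + 1) N with h2 | h2
    · have := hn.2 (i + 1) h2
      omega
    · rw [hn.1 (i + 1) h2]; omega
  · rw [hn.1 i h, hn.1 (i + 1) (by omega)]; exact hc.1 i

theorem sum_shift (f : ℕ → ℕ) (N : ℕ) :
    ∑ i ∈ Finset.range N, f i + f N = f 0 + ∑ i ∈ Finset.range N, f (i + 1) := by
  rw [← Finset.sum_range_succ, Finset.sum_range_succ', add_comm]

theorem sum_tsub (c n : ℕ → ℕ) (N : ℕ) (h : ∀ i, i < N → n i ≤ c i) :
    ∑ i ∈ Finset.range N, c i =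
      ∑ i ∈ Finset.range N, (c i - n i) + ∑ i ∈ Finset.range N, n i := by
  rw [← Finset.sum_add_distrib]
  refine Finset.sum_congr rfl fun i hi => ?_
  have := h i (Finset.mem_range.1 hi)
  omega

theorem WE (t : F) (ht : ∀ n : ℕ, 0 < n → t ^ n ≠ 1) (N L : ℕ) :
    ∀ (c a : ℕ → ℕ), Ad N c → ip (tz t) (Wv t N c) (Ep F L a) ≠ 0 →
      ∑ i ∈ Finset.range N, c i = ∑ i ∈ Finset.range L, a i ∧
      ∀ k, ∑ i ∈ Finset.range N, min (c i) k ≤ ∑ i ∈ Finset.range L, min (a i) k := by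
  induction L with
  | zero =>
    intro c a hc h
    rw [Ep, Finset.prod_range_zero, ip_one] at h
    have h2 := Wv_cc t N c hc.1 h
    have h3 : ∀ i ∈ Finset.range N, c i = 0 := by
      intro i hi
      rw [h2 i (Finset.mem_range.1 hi).le, hc.2 N le_rfl]
    refine ⟨by simpa using h3, fun k => ?_⟩
    rw [Finset.sum_eq_zero]
    · simp
    · intro i hi; rw [h3 i hi]; simp
  | succ L ih =>
    intro c a hc h
    rw [Ep_succ', ip_t_e, shcR_W t ht N c hc.1, ip_sum_left] at h
    obtain ⟨n, hn, h2⟩ := Finset.exists_ne_zero_of_sum_ne_zero h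
    rw [ip_smul_left] at h2
    have h3 := right_ne_zero_of_mul h2
    split_ifs at h3 with h4
    swap
    · rw [ip_zero_left] at h3; exact absurd rfl h3
    obtain ⟨h5, h6⟩ := ih n _ (Box_Ad N c n hc hn) h3
    rw [mem_Box] at hn
    have h7 := sum_tsub c n N (fun i hi => (hn.2 i hi).2)
    rw [Finset.sum_range_succ' a]
    refine ⟨by omega, fun k => ?_⟩
    rw [Finset.sum_range_succ' (fun i => min (a i) k)]
    have h8 := h6 k
    have h9 : ∑ i ∈ Finset.range N, min (c i) k ≤
        ∑ i ∈ Finset.range N, (c i - n i) + ∑ i ∈ Finset.range N, min (n i) k := by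
      rw [← Finset.sum_add_distrib]
      exact Finset.sum_le_sum fun i _ => by omega
    have h10 := sum_shift (fun i => min (c i) k) N
    have h11 : ∑ i ∈ Finset.range N, min (c (i + 1)) k ≤ ∑ i ∈ Finset.range N, min (n i) k := by
      refine Finset.sum_le_sum fun i hi => ?_
      have := (hn.2 i (Finset.mem_range.1 hi)).1
      omega
    omega

theorem WE1 (t : F) (ht : ∀ n : ℕ, 0 < n → t ^ n ≠ 1) (N L : ℕ) :
    ∀ (c : ℕ → ℕ), Ad N c → Ad L c → ip (tz t) (Wv t N c) (Ep F L c) = 1 := by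
  induction L with
  | zero =>
    intro c hc h
    rw [Ep, Finset.prod_range_zero, ip_one, Wv_zero t N c (fun i => h.2 i (by omega))]
    simp
  | succ L ih =>
    intro c hc h
    have hs : Ad N (fun i => c (i + 1)) := ⟨fun i => hc.1 _, fun i hi => hc.2 _ (by omega)⟩
    have hs2 : Ad L (fun i => c (i + 1)) := ⟨fun i => h.1 _, fun i hi => h.2 _ (by omega)⟩
    have htel := sum_tsub c (fun i => c (i + 1)) N (fun i _ => hc.1 i)
    beta_reduce at htel
    have hsh := sum_shift c N
    rw [hc.2 N le_rfl] at hsh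
    rw [Ep_succ', ip_t_e, shcR_W t ht N c hc.1, ip_sum_left,
      Finset.sum_eq_single (fun i => c (i + 1))]
    · beta_reduce
      rw [if_pos (by omega), ip_smul_left, ih _ hs hs2, mul_one]
      refine Finset.prod_eq_one fun i _ => ?_
      have := qbinom_self t ht (c i - c (i + 1))
      rwa [Nat.cast_sub (hc.1 i)] at this
    · intro n hn hne
      rw [mem_Box] at hn
      rw [if_neg, smul_zero, ip_zero_left]
      intro h0
      apply hne
      funext i
      rcases Nat.lt_or_ge i N with h1 | h1
      swap
      · rw [hn.1 i h1, hc.2 i h1, hc.2 (i + 1) (by omega)]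
      by_contra hcon
      have h2 : ∑ i ∈ Finset.range N, (c i - n i) < ∑ i ∈ Finset.range N, (c i - c (i + 1)) := by
        refine Finset.sum_lt_sum (fun j hj => ?_) ⟨i, Finset.mem_range.2 h1, ?_⟩
        · have := hn.2 j (Finset.mem_range.1 hj); omega
        · have := hn.2 i h1; omega
      omega
    · intro hnot
      exfalso
      apply hnot
      rw [mem_Box]
      refine ⟨fun i hi => by rw [hc.2 i hi, hc.2 (i + 1) (by omega)], fun i hi => ⟨le_rfl, hc.1 i⟩⟩

theorem shS_ef (r : ℕ) : shft (fun _ => (1 : F)) (ef F (r + 1)) =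
    Polynomial.C (ef F (r + 1)) + Polynomial.X * Polynomial.C (ef F r) := by
  have h := shft_gco (ecf : ℕ → F) (fun _ => 1) 0 (-1) (by intro k; simp [ecf, pow_succ]) r
  simp only [map_zero, zero_mul, sub_zero, map_neg, map_one] at h
  rw [ef, ef, h]
  ring

theorem shS_zero (r : ℕ) (f : Sym F) : shc (fun _ => (1 : F)) r (ef F 0 * f) =
    shc (fun _ => (1 : F)) r f := by rw [ef_zero, one_mul]

theorem shS_succ0 (a : ℕ) (f : Sym F) : shc (fun _ => (1 : F)) 0 (ef F (a + 1) * f) =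
    ef F (a + 1) * shc (fun _ => (1 : F)) 0 f := by rw [shc_id, shc_id]

theorem shS_succ (r a : ℕ) (f : Sym F) : shc (fun _ => (1 : F)) (r + 1) (ef F (a + 1) * f) =
    ef F (a + 1) * shc (fun _ => (1 : F)) (r + 1) f + ef F a * shc (fun _ => (1 : F)) r f := by
  rw [shc, map_mul, shS_ef, add_mul, Polynomial.coeff_add, Polynomial.coeff_C_mul, mul_assoc,
    Polynomial.coeff_X_mul, Polynomial.coeff_C_mul]
  rfl

theorem Ep_update (N : ℕ) (b : ℕ → ℕ) (x : ℕ) :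
    Ep F (N + 1) (Function.update b N x) = ef F x * Ep F N b := by
  rw [Ep_succ, Function.update_self]
  congr 1
  refine Finset.prod_congr rfl fun i hi => ?_
  rw [Finset.mem_range] at hi
  rw [Function.update_of_ne (by omega)]

theorem shS_span (N : ℕ) (a : ℕ → ℕ) : ∀ r, shc (fun _ => (1 : F)) r (Ep F N a) ∈
    Submodule.span F {g | ∃ b, (∀ i, i < N → b i ≤ a i ∧ a i ≤ b i + 1) ∧
      ∑ i ∈ Finset.range N, (a i - b i) = r ∧ g = Ep F N b} := by
  induction N with
  | zero =>
    intro r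
    rw [Ep, Finset.prod_range_zero, shc_one]
    split_ifs with h
    · exact Submodule.subset_span ⟨a, by simp, by simp [h], by simp [Ep]⟩
    · exact Submodule.zero_mem _
  | succ N ih =>
    have key : ∀ x r s, x ≤ a N → a N ≤ x + 1 → a N - x + s = r →
        ef F x * shc (fun _ => (1 : F)) s (Ep F N a) ∈
          Submodule.span F {g | ∃ b, (∀ i, i < N + 1 → b i ≤ a i ∧ a i ≤ b i + 1) ∧
            ∑ i ∈ Finset.range (N + 1), (a i - b i) = r ∧ g = Ep F (N + 1) b} := by
      intro x r s h1 h2 h3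
      have h4 := Submodule.mem_map_of_mem (f := LinearMap.mulLeft F (ef F x)) (ih s)
      rw [Submodule.map_span] at h4
      refine (Submodule.span_le.2 ?_) h4
      rintro _ ⟨_, ⟨b, hb1, hb2, rfl⟩, rfl⟩
      refine Submodule.subset_span ⟨Function.update b N x, ?_, ?_, ?_⟩
      · intro i hi
        by_cases hiN : i = N
        · subst hiN; rw [Function.update_self]; exact ⟨h1, h2⟩
        · rw [Function.update_of_ne hiN]; exact hb1 i (by omega)
      · rw [Finset.sum_range_succ, Function.update_self]
        rw [Finset.sum_congr rfl (fun i hi => by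
          rw [Finset.mem_range] at hi
          rw [Function.update_of_ne (by omega)] :
          ∀ i ∈ Finset.range N, a i - Function.update b N x i = a i - b i), hb2]
        omega
      · rw [Ep_update]; rfl
    intro r
    rw [Ep_succ]
    rcases Nat.eq_zero_or_pos (a N) with h | h
    · rw [h, shS_zero]
      have := key 0 r r (by omega) (by omega) (by omega)
      rwa [ef_zero, one_mul] at this
    · obtain ⟨x, hx⟩ : ∃ x, a N = x + 1 := ⟨a N - 1, by omega⟩
      rw [hx]
      cases r with
      | zero => rw [shS_succ0]; exact key (x + 1) 0 0 (by omega) (by omega) (by omega)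
      | succ r =>
        rw [shS_succ]
        exact Submodule.add_mem _ (key (x + 1) (r + 1) (r + 1) (by omega) (by omega) (by omega))
          (key x (r + 1) r (by omega) (by omega) (by omega))

theorem HE (N K : ℕ) : ∀ (a d : ℕ → ℕ), ip (hz F) (Ep F N a) (Hp F K d) ≠ 0 →
      ∑ j ∈ Finset.range K, d j = ∑ i ∈ Finset.range N, a i ∧
      ∀ k, k ≤ K → ∑ j ∈ Finset.range k, d j ≤ ∑ i ∈ Finset.range N, min (a i) k := by
  induction K with
  | zero =>
    intro a d h
    rw [Hp, Finset.prod_range_zero, ip_one, Ep, map_prod] at h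
    have h3 : ∀ i ∈ Finset.range N, a i = 0 := by
      intro i hi
      by_contra hcon
      exact h (Finset.prod_eq_zero hi (gco_const _ _ hcon))
    refine ⟨by rw [Finset.sum_range_zero, Finset.sum_eq_zero h3], fun k hk => ?_⟩
    rw [show k = 0 by omega]
    simp
  | succ K ih =>
    intro a d h
    rw [Hp_succ', ip_h_h] at h
    have h2 : ∃ b : ℕ → ℕ, ((∀ i, i < N → b i ≤ a i ∧ a i ≤ b i + 1) ∧
      ∑ i ∈ Finset.range N, (a i - b i) = d 0) ∧
        ip (hz F) (Ep F N b) (Hp F K (fun i => d (i + 1))) ≠ 0 := by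
      by_contra hcon
      push Not at hcon
      apply h
      have h3 : Submodule.span F {g | ∃ b, (∀ i, i < N → b i ≤ a i ∧ a i ≤ b i + 1) ∧
          ∑ i ∈ Finset.range N, (a i - b i) = d 0 ∧ g = Ep F N b} ≤
          LinearMap.ker (ipL (hz F) (Hp F K (fun i => d (i + 1)))) := by
        rw [Submodule.span_le]
        rintro _ ⟨b, hb1, hb2, rfl⟩
        exact hcon b ⟨hb1, hb2⟩
      exact h3 (shS_span N a (d 0))
    obtain ⟨b, ⟨hb1, hb2⟩, h4⟩ := h2
    obtain ⟨h5, h6⟩ := ih _ _ h4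
    have h7 := sum_tsub a b N (fun i hi => (hb1 i hi).1)
    refine ⟨by rw [Finset.sum_range_succ']; omega, fun k hk => ?_⟩
    cases k with
    | zero => simp
    | succ k =>
      rw [Finset.sum_range_succ']
      have h8 := h6 k (by omega)
      have h9 : ∑ i ∈ Finset.range N, (a i - b i) + ∑ i ∈ Finset.range N, min (b i) k ≤
          ∑ i ∈ Finset.range N, min (a i) (k + 1) := by
        rw [← Finset.sum_add_distrib]
        refine Finset.sum_le_sum fun i hi => ?_
        have := hb1 i (Finset.mem_range.1 hi)
        omega
      omega

theorem shS_lead (N : ℕ) (a : ℕ → ℕ) :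
    (∀ r, ((Finset.range N).filter fun i => 0 < a i).card < r →
      shc (fun _ => (1 : F)) r (Ep F N a) = 0) ∧
    shc (fun _ => (1 : F)) ((Finset.range N).filter fun i => 0 < a i).card (Ep F N a) =
      Ep F N (fun i => a i - 1) := by
  induction N with
  | zero =>
    simp only [Finset.range_zero, Finset.filter_empty, Finset.card_empty, Ep,
      Finset.prod_empty]
    refine ⟨fun r hr => ?_, ?_⟩
    · rw [shc_one, if_neg (by omega)]
    · rw [shc_one, if_pos rfl]
  | succ N ih =>
    rw [Finset.range_add_one, Finset.filter_insert, Ep_succ, Ep_succ]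
    rcases Nat.eq_zero_or_pos (a N) with h | h
    · rw [if_neg (by omega), h]
      refine ⟨fun r hr => ?_, ?_⟩
      · rw [shS_zero]; exact ih.1 r hr
      · rw [shS_zero, ih.2, ef_zero, one_mul]
    · rw [if_pos h, Finset.card_insert_of_notMem (by simp)]
      obtain ⟨x, hx⟩ : ∃ x, a N = x + 1 := ⟨a N - 1, by omega⟩
      rw [hx]
      refine ⟨fun r hr => ?_, ?_⟩
      · obtain ⟨s, rfl⟩ : ∃ s, r = s + 1 := ⟨r - 1, by omega⟩
        rw [shS_succ, ih.1 s (by omega), ih.1 (s + 1) (by omega)]; ring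
      · rw [shS_succ, ih.2, ih.1 _ (by omega)]; simp

theorem HE1 (N K : ℕ) : ∀ (a d : ℕ → ℕ), (∀ i, i < N → a i ≤ K) →
    (∀ j, j < K → d j = ((Finset.range N).filter fun i => j < a i).card) →
    ip (hz F) (Ep F N a) (Hp F K d) = 1 := by
  induction K with
  | zero =>
    intro a d ha hd
    rw [Hp, Finset.prod_range_zero, ip_one, Ep, map_prod]
    refine Finset.prod_eq_one fun i hi => ?_
    have := ha i (Finset.mem_range.1 hi)
    rw [show a i = 0 by omega, ef_zero, map_one]
  | succ K ih =>
    intro a d ha hd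
    rw [Hp_succ', ip_h_h, hd 0 (by omega), (shS_lead N a).2]
    refine ih _ _ (fun i hi => by have := ha i hi; omega) (fun j hj => ?_)
    rw [hd (j + 1) (by omega)]
    congr 1
    refine Finset.filter_congr fun i _ => ?_
    omega

end Pairings

section PartLevel

variable {F : Type*} [Field F] [CharZero F]

theorem cj_Ad (lam : Partition) (N : ℕ) (h : lam.part 0 ≤ N) : Ad N (cj lam) :=
  ⟨fun i => cj_anti lam (by omega), fun i hi => cj_zero lam (by omega)⟩

theorem Ad_anti {N : ℕ} {c : ℕ → ℕ} (h : Ad N c) (i j : ℕ) (hij : i ≤ j) : c j ≤ c i :=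
  antitone_nat_of_succ_le h.1 hij

theorem Ad_part {N : ℕ} {c : ℕ → ℕ} (h : Ad N c) : ∃ nu : Partition, cj nu = c ∧ nu.part 0 ≤ N :=
  ofConj c (Ad_anti h) N h.2

/-- the dual family -/
def Wp (t : F) (lam : Partition) : Sym F := Wv t (lam.part 0) (cj lam)

/-- the elementary family -/
def El (F : Type*) [Field F] (lam : Partition) : Sym F := Ep F (lam.part 0) (cj lam)

theorem Wp_eq (t : F) (lam : Partition) (N : ℕ) (h : lam.part 0 ≤ N) :
    Wp t lam = Wv t N (cj lam) := by
  induction N, h using Nat.le_induction with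
  | base => rfl
  | succ N hN ih => rw [Wv_stab, ih]; rw [cj_zero lam hN, cj_zero lam (by omega)]

theorem El_eq (lam : Partition) (N : ℕ) (h : lam.part 0 ≤ N) : El F lam = Ep F N (cj lam) := by
  induction N, h using Nat.le_induction with
  | base => rfl
  | succ N hN ih => rw [Ep_succ, ih, cj_zero lam hN, ef_zero, one_mul]

theorem hprod_eq (kap : Partition) (K : ℕ) (h : cj kap 0 ≤ K) :
    hprod F kap = Hp F K (fun j => kap.part j) := by
  rw [hprod, Hp]
  simp only [hsym_eq]
  refine Finset.prod_subset ?_ ?_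
  · intro j hj
    rw [Finsupp.mem_support_iff] at hj
    rw [Finset.mem_range]
    have := (lt_cj kap 0 j).2 (by omega)
    omega
  · intro j _ hj
    rw [Finsupp.notMem_support_iff] at hj
    rw [hj, gco_zero]

theorem dom_refl (lam : Partition) : Partition.Dominates lam lam := ⟨rfl, fun _ => le_rfl⟩

theorem dom_trans {a b c : Partition} (h1 : Partition.Dominates a b)
    (h2 : Partition.Dominates b c) : Partition.Dominates a c :=
  ⟨h2.1.trans h1.1, fun k => (h2.2 k).trans (h1.2 k)⟩

theorem psum_inj {a b : Partition} (h : ∀ k, a.psum k = b.psum k) : a = b := by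
  apply part_ext
  intro j
  have h1 := h j
  have h2 := h (j + 1)
  rw [Partition.psum, Partition.psum] at h1 h2
  rw [Finset.sum_range_succ, Finset.sum_range_succ] at h2
  omega

theorem dom_antisymm {a b : Partition} (h1 : Partition.Dominates a b)
    (h2 : Partition.Dominates b a) : a = b :=
  psum_inj fun k => le_antisymm (h2.2 k) (h1.2 k)

theorem WEl (t : F) (ht : ∀ n : ℕ, 0 < n → t ^ n ≠ 1) (lam mu : Partition)
    (h : ip (tz t) (Wp t lam) (El F mu) ≠ 0) : Partition.Dominates mu lam := by
  obtain ⟨h1, h2⟩ := WE t ht _ _ _ _ (cj_Ad lam _ le_rfl) h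
  refine ⟨?_, fun k => ?_⟩
  · rw [size_eq lam _ le_rfl, size_eq mu _ le_rfl, h1]
  · rw [psum_eq lam _ _ le_rfl, psum_eq mu _ _ le_rfl]; exact h2 k

theorem WEl1 (t : F) (ht : ∀ n : ℕ, 0 < n → t ^ n ≠ 1) (lam : Partition) :
    ip (tz t) (Wp t lam) (El F lam) = 1 :=
  WE1 t ht _ _ _ (cj_Ad lam _ le_rfl) (cj_Ad lam _ le_rfl)

theorem HEl (lam kap : Partition) (h : ¬ Partition.Dominates lam kap) :
    ip (hz F) (El F lam) (hprod F kap) = 0 := by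
  by_contra hcon
  apply h
  refine ⟨?_, fun k => ?_⟩
  · rw [hprod_eq kap _ le_rfl] at hcon
    have := (HE _ _ _ _ hcon).1
    rw [size_eq_psum kap _ le_rfl, size_eq lam _ le_rfl]
    exact this
  · rw [hprod_eq kap (max k (cj kap 0)) (le_max_right _ _)] at hcon
    have := (HE _ _ _ _ hcon).2 k (le_max_left _ _)
    rw [psum_eq lam _ _ le_rfl]
    exact this

theorem HEl1 (lam : Partition) : ip (hz F) (El F lam) (hprod F lam) = 1 := by
  rw [hprod_eq lam _ le_rfl]
  refine HE1 _ _ _ _ (fun i _ => cj_anti lam (by omega)) (fun j _ => ?_)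
  have : ((Finset.range (lam.part 0)).filter fun i => j < cj lam i) =
      Finset.range (lam.part j) := by
    ext i
    rw [Finset.mem_filter, Finset.mem_range, Finset.mem_range, lt_cj]
    have := lam.antitone' (Nat.zero_le j)
    omega
  rw [this, Finset.card_range]

theorem gco_surj (a : ℕ → F) (ha : ∀ k, a k ≠ 0) :
    Function.Surjective (MvPolynomial.aeval (R := F) (fun n => gco a (n + 1))) := by
  have hX : ∀ n, (MvPolynomial.X n : Sym F) ∈
      (MvPolynomial.aeval (R := F) (fun n => gco a (n + 1))).range := by
    intro n
    induction n using Nat.strong_induction_on with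
    | _ n ih =>
      set A := (MvPolynomial.aeval (R := F) (fun n => gco a (n + 1))).range with hA
      have hg : ∀ m, gco a m ∈ A := by
        intro m
        cases m with
        | zero => rw [gco_zero]; exact A.one_mem
        | succ m => exact ⟨MvPolynomial.X m, by simp⟩
      have hC : ∀ x : F, (MvPolynomial.C x : Sym F) ∈ A := fun x => A.algebraMap_mem x
      have h := gco_rec a n
      rw [Finset.Nat.sum_antidiagonal_eq_sum_range_succ_mk, Finset.sum_range_succ,
        Nat.sub_self, gco_zero, mul_one] at h
      have h2 : MvPolynomial.C (a n) * MvPolynomial.X n ∈ A := by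
        rw [← sub_eq_iff_eq_add'] at h
        rw [← h]
        refine A.sub_mem (A.mul_mem (A.add_mem (natCast_mem A n) A.one_mem) (hg _)) ?_
        refine A.sum_mem fun k hk => ?_
        exact A.mul_mem (A.mul_mem (hC _) (ih k (Finset.mem_range.1 hk))) (hg _)
      have h3 : (MvPolynomial.X n : Sym F) =
          MvPolynomial.C (a n)⁻¹ * (MvPolynomial.C (a n) * MvPolynomial.X n) := by
        rw [← mul_assoc, ← MvPolynomial.C_mul, inv_mul_cancel₀ (ha n), MvPolynomial.C_1, one_mul]
      rw [h3]
      exact A.mul_mem (hC _) h2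
  intro f
  have : f ∈ (MvPolynomial.aeval (R := F) (fun n => gco a (n + 1))).range := by
    induction f using MvPolynomial.induction_on with
    | C x => exact Subalgebra.algebraMap_mem _ x
    | add f g hf hg => exact Subalgebra.add_mem _ hf hg
    | mul_X f n hf => exact Subalgebra.mul_mem _ hf (hX n)
  exact this

theorem gco_span (a : ℕ → F) (ha : ∀ k, a k ≠ 0) (V : Submodule F (Sym F))
    (h : ∀ kap : Partition, ∏ j ∈ kap.part.support, gco a (kap.part j) ∈ V) (f : Sym F) :
    f ∈ V := by
  obtain ⟨g, rfl⟩ := gco_surj a ha f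
  have : (⊤ : Submodule F (Sym F)) ≤
      V.comap (MvPolynomial.aeval (R := F) (fun n => gco a (n + 1))).toLinearMap := by
    rw [← (MvPolynomial.basisMonomials ℕ F).span_eq, Submodule.span_le]
    rintro _ ⟨d, rfl⟩
    obtain ⟨kap, rfl⟩ := dv_surj d
    have h1 := h kap
    rw [MvPolynomial.coe_basisMonomials]
    beta_reduce
    rw [← pprod_eq]
    show MvPolynomial.aeval (R := F) (fun n => gco a (n + 1)) (pprod kap) ∈ V
    rw [pprod, map_prod]
    convert h1 using 1
    refine Finset.prod_congr rfl fun j hj => ?_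
    rw [Finsupp.mem_support_iff] at hj
    rw [MvPolynomial.aeval_X, Nat.sub_add_cancel (by omega)]
  exact this (Submodule.mem_top (x := g))

theorem h_nondeg (f : Sym F) (h : ∀ kap, ip (hz F) f (hprod F kap) = 0) : f = 0 := by
  refine ip_nondeg (hz F) hz_ne f fun g => ?_
  have := gco_span (fun _ => (1 : F)) (fun _ => one_ne_zero) (LinearMap.ker (ipR (hz F) f))
    (fun kap => by
      have h1 := h kap
      rw [hprod] at h1
      simp only [hsym_eq] at h1
      exact h1) g
  exact this

/-- triangular expansion -/
theorem tri (X : Partition → Sym F) (h1 : ∀ nu, ip (hz F) (X nu) (hprod F nu) = 1)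
    (h2 : ∀ nu kap, ¬ Partition.Dominates nu kap → ip (hz F) (X nu) (hprod F kap) = 0)
    (D : Finset Partition) (hD : ∀ nu ∈ D, ∀ kap, Partition.Dominates nu kap → kap ∈ D)
    (f : Sym F) (hf : ∀ kap, kap ∉ D → ip (hz F) f (hprod F kap) = 0) :
    f ∈ Submodule.span F (X '' (D : Set Partition)) := by
  classical
  induction hn : D.card generalizing D f with
  | zero =>
    rw [Finset.card_eq_zero] at hn
    subst hn
    rw [h_nondeg f (fun kap => hf kap (by simp))]
    exact Submodule.zero_mem _
  | succ n ih =>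
    obtain ⟨nu, hnu⟩ := Finset.exists_maximalFor (fun lam : Partition => lam.psum) D
      (Finset.card_pos.1 (by omega))
    have hm : ∀ kap ∈ D, Partition.Dominates kap nu → kap = nu := by
      intro kap hk hd
      have := hnu.2 hk (fun k => hd.2 k)
      exact psum_inj fun k => le_antisymm (this k) (hd.2 k)
    have hsub : f - ip (hz F) f (hprod F nu) • X nu ∈
        Submodule.span F (X '' ((D.erase nu : Finset Partition) : Set Partition)) := by
      refine ih (D.erase nu) ?_ _ ?_ ?_
      · intro a ha b hb
        rw [Finset.mem_erase] at ha ⊢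
        refine ⟨?_, hD a ha.2 b hb⟩
        rintro rfl
        exact ha.1 (hm a ha.2 hb)
      · intro kap hk
        rw [ip_sub_left, ip_smul_left]
        by_cases hkn : kap = nu
        · subst hkn; rw [h1]; ring
        · have hkD : kap ∉ D := fun h => hk (Finset.mem_erase.2 ⟨hkn, h⟩)
          rw [hf kap hkD, h2 nu kap (fun h => hkD (hD nu hnu.1 kap h))]; ring
      · rw [Finset.card_erase_of_mem hnu.1, hn]; rfl
    have h3 : f = (f - ip (hz F) f (hprod F nu) • X nu) + ip (hz F) f (hprod F nu) • X nu := by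
      ring
    rw [h3]
    refine Submodule.add_mem _ ?_ (Submodule.smul_mem _ _ (Submodule.subset_span ⟨nu, hnu.1, rfl⟩))
    exact Submodule.span_mono (Set.image_mono (by simp)) hsub

open Classical in
/-- partitions dominated by `lam` -/
def dn (lam : Partition) : Finset Partition :=
  (psz lam.size).filter fun nu => Partition.Dominates lam nu

theorem mem_dn (lam nu : Partition) : nu ∈ dn lam ↔ Partition.Dominates lam nu := by
  classical
  unfold dn
  rw [Finset.mem_filter, mem_psz]
  exact ⟨fun h => h.2, fun h => ⟨h.1, h⟩⟩

theorem El_indep : LinearIndependent F (El F : Partition → Sym F) := by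
  classical
  rw [linearIndependent_iff']
  intro s g hg
  by_contra hcon
  push Not at hcon
  obtain ⟨i, hi, hgi⟩ := hcon
  obtain ⟨nu, hnu⟩ := Finset.exists_maximalFor (fun lam : Partition => lam.psum)
    (s.filter fun i => g i ≠ 0) ⟨i, Finset.mem_filter.2 ⟨hi, hgi⟩⟩
  have h0 := congrArg (fun f => ip (hz F) f (hprod F nu)) hg
  have hnu1 := Finset.mem_filter.1 hnu.1
  simp only [ip_sum_left, ip_smul_left, ip_zero_left] at h0
  rw [Finset.sum_eq_single nu] at h0
  · rw [HEl1, mul_one] at h0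
    exact hnu1.2 h0
  · intro kap hk hne
    by_cases hgk : g kap = 0
    · rw [hgk, zero_mul]
    · rw [HEl, mul_zero]
      intro hd
      have := hnu.2 (Finset.mem_filter.2 ⟨hk, hgk⟩) (fun k => hd.2 k)
      exact hne (psum_inj fun k => le_antisymm (this k) (hd.2 k))
  · intro h; exact absurd hnu1.1 h

theorem e_Wp (t : F) (ht : ∀ n : ℕ, 0 < n → t ^ n ≠ 1) (nu : Partition) (r : ℕ) :
    ef F r * Wp t nu ∈ Submodule.span F {g | ∃ rho : Partition, rho.size = nu.size + r ∧
      (∀ k, rho.psum k ≤ nu.psum k + min r k) ∧ g = Wp t rho} := by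
  set N := nu.part 0 with hN
  have h := Esup t ht N (cj nu) (cj_Ad nu N le_rfl).1 r
  refine (Submodule.span_mono ?_) h
  rintro _ ⟨n, ⟨hn1, hn2, hn3⟩, rfl⟩
  rw [cj_zero nu le_rfl] at hn1
  set n' : ℕ → ℕ := fun i => if i ≤ N then n i else 0 with hn'
  have e1 : ∀ i, i ≤ N + 1 → n' i = n i := by
    intro i hi
    rw [hn']
    beta_reduce
    split_ifs with h1
    · rfl
    · rw [show i = N + 1 by omega, hn1]
  have hA : Ad (N + 1) n' := by
    refine ⟨fun i => ?_, fun i hi => ?_⟩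
    · rcases Nat.lt_or_ge N i with h1 | h1
      · rw [hn']
        beta_reduce
        rw [if_neg (by omega)]; omega
      · rw [e1 i (by omega), e1 (i + 1) (by omega)]
        have := hn2 i h1
        omega
    · rw [hn']
      beta_reduce
      rw [if_neg (by omega)]
  obtain ⟨rho, hr1, hr2⟩ := Ad_part hA
  have e2 : ∀ f : ℕ → ℕ, ∑ i ∈ Finset.range (N + 1), f (n' i) =
      ∑ i ∈ Finset.range (N + 1), f (n i) := by
    intro f
    exact Finset.sum_congr rfl fun i hi => by rw [e1 i (Finset.mem_range.1 hi).le]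
  refine ⟨rho, ?_, fun k => ?_, ?_⟩
  · rw [size_eq rho _ hr2, hr1, e2 (fun x => x), hn3, size_eq nu (N + 1) (by omega)]; omega
  · rw [psum_eq rho _ k hr2, hr1, e2 (fun x => min x k), psum_eq nu (N + 1) k (by omega)]
    have h4 := sum_tsub n (cj nu) (N + 1) (fun i hi => (hn2 i (by omega)).1)
    have h5 : ∑ i ∈ Finset.range (N + 1), min (n i) k ≤
        ∑ i ∈ Finset.range (N + 1), (n i - cj nu i) +
          ∑ i ∈ Finset.range (N + 1), min (cj nu i) k := by
      rw [← Finset.sum_add_distrib]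
      exact Finset.sum_le_sum fun i _ => by omega
    have h6 := sum_shift (fun i => min (n i) k) (N + 1)
    have h7 : ∑ i ∈ Finset.range (N + 1), min (n (i + 1)) k ≤
        ∑ i ∈ Finset.range (N + 1), min (cj nu i) k := by
      refine Finset.sum_le_sum fun i hi => ?_
      have := (hn2 i (by have := Finset.mem_range.1 hi; omega)).2
      omega
    omega
  · rw [Wp_eq t rho _ hr2, hr1]
    exact Wv_congr t _ _ _ fun i hi => (e1 i hi).symm

theorem Ep_W (t : F) (ht : ∀ n : ℕ, 0 < n → t ^ n ≠ 1) (N : ℕ) (a : ℕ → ℕ) :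
    Ep F N a ∈ Submodule.span F {g | ∃ rho : Partition, rho.size = ∑ i ∈ Finset.range N, a i ∧
      (∀ k, rho.psum k ≤ ∑ i ∈ Finset.range N, min (a i) k) ∧ g = Wp t rho} := by
  induction N with
  | zero =>
    obtain ⟨rho, hr1, hr2⟩ := Ad_part (N := 0) (c := fun _ => 0) ⟨by simp, by simp⟩
    refine Submodule.subset_span ⟨rho, ?_, fun k => ?_, ?_⟩
    · rw [size_eq rho 0 hr2]; rfl
    · rw [psum_eq rho 0 k hr2]; rfl
    · rw [Wp_eq t rho 0 hr2]; rfl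
  | succ N ih =>
    rw [Ep_succ]
    have h4 := Submodule.mem_map_of_mem (f := LinearMap.mulLeft F (ef F (a N))) ih
    rw [Submodule.map_span] at h4
    refine (Submodule.span_le.2 ?_) h4
    rintro _ ⟨_, ⟨nu, h1, h2, rfl⟩, rfl⟩
    refine (Submodule.span_mono ?_) (e_Wp t ht nu (a N))
    rintro _ ⟨rho, h5, h6, rfl⟩
    refine ⟨rho, ?_, fun k => ?_, rfl⟩
    · rw [h5, h1, Finset.sum_range_succ]
    · rw [Finset.sum_range_succ]
      have := h6 k
      have := h2 k
      omega

theorem El_W (t : F) (ht : ∀ n : ℕ, 0 < n → t ^ n ≠ 1) (lam : Partition) :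
    El F lam ∈ Submodule.span F (Wp t '' (dn lam : Set Partition)) := by
  refine (Submodule.span_mono ?_) (Ep_W t ht (lam.part 0) (cj lam))
  rintro _ ⟨rho, h1, h2, rfl⟩
  refine ⟨rho, ?_, rfl⟩
  rw [Finset.mem_coe, mem_dn]
  refine ⟨?_, fun k => ?_⟩
  · rw [h1, size_eq lam _ le_rfl]
  · rw [psum_eq lam _ k le_rfl]; exact h2 k

theorem W_span (t : F) (ht : ∀ n : ℕ, 0 < n → t ^ n ≠ 1) (f : Sym F) :
    f ∈ Submodule.span F (Set.range (Wp t)) := by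
  refine gco_span ecf (fun k => by rw [ecf]; exact pow_ne_zero _ (by simp)) _ (fun kap => ?_) f
  have : ∏ j ∈ kap.part.support, gco (ecf : ℕ → F) (kap.part j) =
      Ep F (cj kap 0) (fun j => kap.part j) := by
    rw [Ep]
    refine Finset.prod_subset ?_ ?_
    · intro j hj
      rw [Finsupp.mem_support_iff] at hj
      rw [Finset.mem_range]
      have := (lt_cj kap 0 j).2 (by omega)
      omega
    · intro j _ hj
      rw [Finsupp.notMem_support_iff] at hj
      rw [hj, gco_zero]
  rw [this]
  refine (Submodule.span_mono ?_) (Ep_W t ht _ _)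
  rintro _ ⟨rho, h1, h2, rfl⟩
  exact ⟨rho, rfl⟩

theorem W_El (t : F) (ht : ∀ n : ℕ, 0 < n → t ^ n ≠ 1) (lam : Partition) :
    Wp t lam ∈ Submodule.span F (El F '' (dn lam : Set Partition)) := by
  classical
  have hle : Submodule.span F (El F '' (dn lam : Set Partition)) ≤
      Submodule.span F (Wp t '' (dn lam : Set Partition)) := by
    rw [Submodule.span_le]
    rintro _ ⟨nu, hnu, rfl⟩
    refine (Submodule.span_mono (Set.image_mono ?_)) (El_W t ht nu)
    intro kap hk
    rw [Finset.mem_coe, mem_dn] at *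
    exact dom_trans hnu hk
  have hfin : Module.Finite F (Submodule.span F (Wp t '' (dn lam : Set Partition))) :=
    Module.Finite.span_of_finite F ((dn lam).finite_toSet.image _)
  have hr : Module.finrank F (Submodule.span F (Wp t '' (dn lam : Set Partition))) ≤
      Module.finrank F (Submodule.span F (El F '' (dn lam : Set Partition))) := by
    have h1 : Module.finrank F (Submodule.span F (Wp t '' (dn lam : Set Partition))) ≤
        (dn lam).card := by
      rw [← Finset.coe_image]
      exact (finrank_span_finset_le_card _).trans Finset.card_image_le
    have h2 : Module.finrank F (Submodule.span F (El F '' (dn lam : Set Partition))) =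
        (dn lam).card := by
      have h3 : LinearIndependent F (fun i : (dn lam) => El F i.1) :=
        El_indep.comp (fun i : (dn lam) => i.1) Subtype.val_injective
      have h4 := finrank_span_eq_card h3
      rw [Fintype.card_coe] at h4
      rw [← h4]
      have h5 : El F '' (dn lam : Set Partition) =
          Set.range (fun i : (dn lam) => (El F i.1 : Sym F)) := by
        ext x
        constructor
        · rintro ⟨y, hy, rfl⟩
          exact ⟨⟨y, hy⟩, rfl⟩
        · rintro ⟨y, rfl⟩
          exact ⟨y.1, y.2, rfl⟩
      rw [h5]
    omega
  rw [Submodule.eq_of_le_of_finrank_le hle hr]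
  refine Submodule.subset_span ⟨lam, ?_, rfl⟩
  rw [Finset.mem_coe, mem_dn]
  exact dom_refl lam

theorem span_ne {ι : Type*} (X : ι → Sym F) (S : Set ι) (l : Sym F →ₗ[F] F) (f : Sym F)
    (hf : f ∈ Submodule.span F (X '' S)) (h : l f ≠ 0) : ∃ i ∈ S, l (X i) ≠ 0 := by
  by_contra hcon
  push Not at hcon
  apply h
  have : Submodule.span F (X '' S) ≤ LinearMap.ker l := by
    rw [Submodule.span_le]
    rintro _ ⟨i, hi, rfl⟩
    exact hcon i hi
  exact this hf

theorem W_tri (t : F) (ht : ∀ n : ℕ, 0 < n → t ^ n ≠ 1) (lam kap : Partition)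
    (h : ¬ Partition.Dominates lam kap) : ip (hz F) (Wp t lam) (hprod F kap) = 0 := by
  by_contra hcon
  obtain ⟨nu, h1, h2⟩ := span_ne _ _ (ipL (hz F) (hprod F kap)) _ (W_El t ht lam) hcon
  rw [Finset.mem_coe, mem_dn] at h1
  apply h
  refine dom_trans h1 ?_
  by_contra h3
  exact h2 (HEl nu kap h3)

theorem dn_closed (lam : Partition) :
    ∀ nu ∈ dn lam, ∀ kap, Partition.Dominates nu kap → kap ∈ dn lam := by
  intro nu h kap h2
  rw [mem_dn] at *
  exact dom_trans h h2

theorem W_P (t : F) (ht : ∀ n : ℕ, 0 < n → t ^ n ≠ 1) (P : Partition → Sym F)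
    (hP : IsMacdonald (0 : F) t P) (lam mu : Partition) [Decidable (lam = mu)] :
    ip (tz t) (Wp t lam) (P mu) = if lam = mu then 1 else 0 := by
  classical
  obtain ⟨p1, p2, p3⟩ := hP
  simp only [inner_tz, inner_hz t ht] at p1 p2 p3
  have hPd : P mu - El F mu ∈
      Submodule.span F (El F '' (((dn mu).erase mu : Finset Partition) : Set Partition)) := by
    refine tri (El F) HEl1 HEl _ ?_ _ ?_
    · intro nu hnu kap hk
      rw [Finset.mem_erase] at *
      refine ⟨?_, dn_closed mu nu hnu.2 kap hk⟩
      rintro rfl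
      exact hnu.1 (dom_antisymm hk ((mem_dn _ _).1 hnu.2))
    · intro kap hk
      rw [ip_sub_left]
      by_cases h : kap = mu
      · subst h; rw [p2, HEl1, sub_self]
      · have : ¬ Partition.Dominates mu kap := fun h2 =>
          hk (Finset.mem_erase.2 ⟨h, (mem_dn _ _).2 h2⟩)
        rw [p3 _ _ this, HEl _ _ this, sub_self]
  have hd : ip (tz t) (Wp t lam) (P mu - El F mu) ≠ 0 →
      Partition.Dominates mu lam ∧ lam ≠ mu := by
    intro h
    obtain ⟨nu, h1, h2⟩ := span_ne _ _ (ipR (tz t) (Wp t lam)) _ hPd h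
    rw [Finset.mem_coe, Finset.mem_erase, mem_dn] at h1
    have h3 := WEl t ht lam nu h2
    refine ⟨dom_trans h1.2 h3, ?_⟩
    rintro rfl
    exact h1.1 (dom_antisymm h3 h1.2)
  have hsplit : ip (tz t) (Wp t lam) (P mu) =
      ip (tz t) (Wp t lam) (P mu - El F mu) + ip (tz t) (Wp t lam) (El F mu) := by
    rw [← ip_add_right, sub_add_cancel]
  split_ifs with h
  · subst h
    rw [hsplit, WEl1 t ht, add_eq_right]
    by_contra hcon
    exact (hd hcon).2 rfl
  · by_contra hcon
    have d1 : Partition.Dominates mu lam := by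
      by_contra hnd
      apply hcon
      rw [hsplit]
      have a1 : ip (tz t) (Wp t lam) (P mu - El F mu) = 0 := by
        by_contra hh; exact hnd (hd hh).1
      have a2 : ip (tz t) (Wp t lam) (El F mu) = 0 := by
        by_contra hh; exact hnd (WEl t ht _ _ hh)
      rw [a1, a2, add_zero]
    have hW : Wp t lam ∈ Submodule.span F (P '' (dn lam : Set Partition)) :=
      tri P p2 p3 _ (dn_closed lam) _ fun kap hk =>
        W_tri t ht lam kap fun h => hk ((mem_dn _ _).2 h)
    obtain ⟨nu, h1, h2⟩ := span_ne _ _ (ipL (tz t) (P mu)) _ hW hcon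
    have h3 : nu = mu := by
      by_contra hne
      exact h2 (p1 nu mu hne)
    subst h3
    rw [Finset.mem_coe, mem_dn] at h1
    exact h (dom_antisymm h1 d1)

end PartLevel

section FinalPart

variable {F : Type*} [Field F] [CharZero F]

theorem eh_rel (r : ℕ) :
    ∑ p ∈ Finset.HasAntidiagonal.antidiagonal r,
      MvPolynomial.C ((-1 : F) ^ p.1) * ef F p.1 * gco (fun _ => (1 : F)) p.2 =
      if r = 0 then 1 else 0 := by
  have e : (fun k => ((-1 : F) ^ (k + 1) * ecf k) + 1) = fun _ => (0 : F) := by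
    funext k
    rw [ecf, pow_succ, mul_right_comm, ← mul_pow]
    simp
  have h := gco_mul (fun k => (-1 : F) ^ (k + 1) * ecf k) (fun _ => (1 : F)) r
  rw [e, gco_null] at h
  rw [← h]
  refine Finset.sum_congr rfl fun p _ => ?_
  rw [← gco_scale, ef]

/-- coefficients -/
def cfB (t : F) (N : ℕ) (c n : ℕ → ℕ) : F :=
  ∏ i ∈ Finset.range N, qbinom t ((c i : ℤ) - c (i + 1)) ((c i : ℤ) - n i)

/-- weights -/
def wB (N : ℕ) (c n : ℕ → ℕ) : ℕ := ∑ i ∈ Finset.range N, (c i - n i)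

/-- skew coefficients -/
def skB (t : F) (N : ℕ) (m n : ℕ → ℕ) : F :=
  ∏ i ∈ Finset.range N, (t ^ ((n i - m i).choose 2) *
          qbinom t ((n i : ℤ) - m (i + 1)) ((n i : ℤ) - m i))

/-- recursion operator -/
def opB (t : F) (N : ℕ) (x : (ℕ → ℕ) → ℕ → F) (c : ℕ → ℕ) (r : ℕ) : F :=
  ∑ n ∈ Box N c, cfB t N c n * (if wB N c n ≤ r then (-1) ^ wB N c n * x n (r - wB N c n) else 0)

theorem anti_sum (d r : ℕ) (x : ℕ → F) :
    ∑ p ∈ Finset.HasAntidiagonal.antidiagonal r,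
      (-1 : F) ^ p.1 * (if p.1 = d then x p.2 else 0) =
      if d ≤ r then (-1) ^ d * x (r - d) else 0 := by
  rw [Finset.Nat.sum_antidiagonal_eq_sum_range_succ_mk]
  split_ifs with h
  · rw [Finset.sum_eq_single d]
    · simp
    · intro b _ hb
      simp [hb]
    · intro hd
      exact absurd (Finset.mem_range.2 (by omega)) hd
  · refine Finset.sum_eq_zero fun b hb => ?_
    have := Finset.mem_range.1 hb
    dsimp only
    rw [if_neg (by omega), mul_zero]

theorem opB_x (t : F) (ht : ∀ n : ℕ, 0 < n → t ^ n ≠ 1) (N : ℕ) (c : ℕ → ℕ) (hc : Ad N c)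
    (f : Sym F) (r : ℕ) :
    opB t N (fun n s => ip (tz t) (Wv t N n) (gco (fun _ => (1 : F)) s * f)) c r =
      if r = 0 then ip (tz t) (Wv t N c) f else 0 := by
  have h : ip (tz t) (Wv t N c) ((∑ p ∈ Finset.HasAntidiagonal.antidiagonal r,
      MvPolynomial.C ((-1 : F) ^ p.1) * ef F p.1 * gco (fun _ => (1 : F)) p.2) * f) =
      if r = 0 then ip (tz t) (Wv t N c) f else 0 := by
    rw [eh_rel]
    split_ifs
    · rw [one_mul]
    · rw [zero_mul, ip_zero_right]
  rw [← h, Finset.sum_mul, ip_sum_right, opB]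
  have e : ∀ p ∈ Finset.HasAntidiagonal.antidiagonal r, ip (tz t) (Wv t N c)
      (MvPolynomial.C ((-1 : F) ^ p.1) * ef F p.1 * gco (fun _ => (1 : F)) p.2 * f) =
      ∑ n ∈ Box N c, cfB t N c n * ((-1 : F) ^ p.1 * (if p.1 = wB N c n then
        ip (tz t) (Wv t N n) (gco (fun _ => (1 : F)) p.2 * f) else 0)) := by
    intro p _
    rw [mul_assoc, mul_assoc, ← MvPolynomial.smul_eq_C_mul, ip_smul_right, ip_t_e,
      shcR_W t ht N c hc.1, ip_sum_left, Finset.mul_sum]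
    refine Finset.sum_congr rfl fun n _ => ?_
    rw [ip_smul_left, cfB, wB]
    split_ifs
    · ring
    · rw [ip_zero_left]; ring
  rw [Finset.sum_congr rfl e, Finset.sum_comm]
  refine Finset.sum_congr rfl fun n _ => ?_
  rw [← Finset.mul_sum, anti_sum (wB N c n) r
    (fun s => ip (tz t) (Wv t N n) (gco (fun _ => (1 : F)) s * f))]

open Classical in
theorem opB_y (t : F) (ht : ∀ n : ℕ, 0 < n → t ^ n ≠ 1) (N : ℕ) (c m : ℕ → ℕ) (hc : Ad N c)
    (hm : Ad N m) (r : ℕ) :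
    opB t N (fun n s => if ∑ i ∈ Finset.range N, n i = ∑ i ∈ Finset.range N, m i + s then
      skB t N m n else 0) c r =
      if r = 0 then (if c = m then 1 else 0) else 0 := by
  have e : opB t N (fun n s => if ∑ i ∈ Finset.range N, n i = ∑ i ∈ Finset.range N, m i + s then
      skB t N m n else 0) c r = ∑ n ∈ Box N c, cfB t N c n *
      (if ∑ i ∈ Finset.range N, c i = ∑ i ∈ Finset.range N, m i + r then
        (-1) ^ wB N c n * skB t N m n else 0) := by
    rw [opB]
    refine Finset.sum_congr rfl fun n hn => ?_
    rw [mem_Box] at hn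
    have h1 := sum_tsub c n N (fun i hi => (hn.2 i hi).2)
    rw [← wB] at h1
    congr 1
    by_cases h2 : wB N c n ≤ r
    · rw [if_pos h2]
      by_cases h3 : ∑ i ∈ Finset.range N, c i = ∑ i ∈ Finset.range N, m i + r
      · rw [if_pos h3, if_pos (by omega)]
      · rw [if_neg h3, if_neg (by omega), mul_zero]
    · rw [if_neg h2]
      split_ifs with h3
      · have h4 : ∑ i ∈ Finset.range N, n i < ∑ i ∈ Finset.range N, m i := by omega
        obtain ⟨i, hi, h5⟩ := Finset.exists_lt_of_sum_lt h4
        rw [skB, Finset.prod_eq_zero hi, mul_zero]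
        rw [qbinom_neg _ _ _ (by omega), mul_zero]
      · rfl
  rw [e]
  by_cases h3 : ∑ i ∈ Finset.range N, c i = ∑ i ∈ Finset.range N, m i + r
  · have h := inv_id t ht N c m hm.1 hc.2 hm.2
    have h' : ∑ n ∈ Box N c, cfB t N c n *
      (if ∑ i ∈ Finset.range N, c i = ∑ i ∈ Finset.range N, m i + r then
        (-1) ^ wB N c n * skB t N m n else 0) = if c = m then 1 else 0 := by
      rw [← h]
      refine Finset.sum_congr rfl fun n _ => ?_
      rw [if_pos h3, ← mul_assoc]
      rfl
    rw [h']
    by_cases hr : r = 0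
    · rw [if_pos hr]
    · rw [if_neg hr, if_neg]
      rintro rfl
      omega
  · rw [Finset.sum_eq_zero (fun n _ => by rw [if_neg h3, mul_zero])]
    split_ifs with h1 h2
    · subst h1 h2
      exact absurd rfl h3
    · rfl
    · rfl

theorem opB_uniq (t : F) (ht : ∀ n : ℕ, 0 < n → t ^ n ≠ 1) (N : ℕ) (x y : (ℕ → ℕ) → ℕ → F)
    (h : ∀ c, Ad N c → ∀ r, opB t N x c r = opB t N y c r) (k : ℕ) :
    ∀ c, Ad N c → ∑ i ∈ Finset.range N, c i = k → ∀ r, x c r = y c r := by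
  classical
  induction k using Nat.strong_induction_on with
  | _ k ih =>
    intro c hc hk r
    have h1 := h c hc r
    have hcB : c ∈ Box N c := by
      rw [mem_Box]
      exact ⟨fun i _ => rfl, fun i _ => ⟨hc.1 i, le_rfl⟩⟩
    rw [opB, opB, ← Finset.add_sum_erase _ _ hcB, ← Finset.add_sum_erase _ _ hcB] at h1
    have h2 : ∀ n ∈ (Box N c).erase c, cfB t N c n *
        (if wB N c n ≤ r then (-1) ^ wB N c n * x n (r - wB N c n) else 0) = cfB t N c n *
        (if wB N c n ≤ r then (-1) ^ wB N c n * y n (r - wB N c n) else 0) := by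
      intro n hn
      rw [Finset.mem_erase] at hn
      have h3 := (mem_Box _ _ _).1 hn.2
      have hlt : ∑ i ∈ Finset.range N, n i < k := by
        rw [← hk]
        refine Finset.sum_lt_sum (fun i hi => (h3.2 i (Finset.mem_range.1 hi)).2) ?_
        by_contra hcon
        push Not at hcon
        apply hn.1
        funext i
        rcases Nat.lt_or_ge i N with hi | hi
        · exact le_antisymm (h3.2 i hi).2 (hcon i (Finset.mem_range.2 hi))
        · exact h3.1 i hi
      rw [ih _ hlt n (Box_Ad N c n hc hn.2) rfl]
    rw [Finset.sum_congr rfl h2] at h1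
    have h4 := add_right_cancel h1
    have hw : wB N c c = 0 := by simp [wB]
    have hcf : cfB t N c c = 1 := by
      rw [cfB]
      refine Finset.prod_eq_one fun i _ => ?_
      have h5 := hc.1 i
      have h6 : (c i : ℤ) - c (i + 1) = ((c i - c (i + 1) : ℕ) : ℤ) := by omega
      rw [sub_self, h6, qbinom_zero t ht]
    rw [hw, hcf] at h4
    simpa using h4

open Classical in
theorem W_hP (t : F) (ht : ∀ n : ℕ, 0 < n → t ^ n ≠ 1) (P : Partition → Sym F)
    (hP : IsMacdonald (0 : F) t P) (lam mu : Partition) (r : ℕ) :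
    ip (tz t) (Wp t lam) (hsym F r * P mu) =
      if lam.size = mu.size + r then skHL t lam mu else 0 := by
  obtain ⟨N, h1, h2⟩ : ∃ N, lam.part 0 ≤ N ∧ mu.part 0 ≤ N :=
    ⟨_, le_max_left _ _, le_max_right _ _⟩
  rw [Wp_eq t lam N h1, hsym_eq, size_eq lam N h1, size_eq mu N h2, skHL_eq t ht lam mu N h1 h2]
  refine opB_uniq t ht N
    (fun n s => ip (tz t) (Wv t N n) (gco (fun _ => (1 : F)) s * P mu))
    (fun n s => if ∑ i ∈ Finset.range N, n i = ∑ i ∈ Finset.range N, cj mu i + s then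
      skB t N (cj mu) n else 0) ?_ _ (cj lam) (cj_Ad lam N h1) rfl r
  intro c hc s
  rw [opB_x t ht N c hc, opB_y t ht N c (cj mu) hc (cj_Ad mu N h2)]
  obtain ⟨nu, rfl, h3⟩ := Ad_part hc
  rw [← Wp_eq t nu N h3, W_P t ht P hP]
  congr 1
  by_cases h : nu = mu
  · rw [if_pos h, if_pos (by rw [h])]
  · rw [if_neg h, if_neg]
    exact fun h4 => h (cj_ext fun j => congrFun h4 j)

theorem pieri_gen (t : F) (ht : ∀ n : ℕ, 0 < n → t ^ n ≠ 1) (P : Partition → Sym F)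
    (hP : IsMacdonald (0 : F) t P) (mu : Partition) (r : ℕ) :
    P mu * hsym F r =
      ∑ᶠ (lam : Partition) (_ : lam.size = mu.size + r), skHL t lam mu • P lam := by
  classical
  have e : ∑ᶠ (lam : Partition) (_ : lam.size = mu.size + r), skHL t lam mu • P lam =
      ∑ lam ∈ psz (mu.size + r), skHL t lam mu • P lam :=
    finsum_mem_eq_finite_toFinset_sum _ (finite_size (mu.size + r))
  rw [e, ← sub_eq_zero]
  refine ip_nondeg (tz t) (tz_ne t ht) _ fun g => ?_
  rw [ip_comm]
  have hle : Submodule.span F (Set.range (Wp t)) ≤ LinearMap.ker (ipL (tz t)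
      (P mu * hsym F r - ∑ lam ∈ psz (mu.size + r), skHL t lam mu • P lam)) := by
    rw [Submodule.span_le]
    rintro _ ⟨lam, rfl⟩
    show ip (tz t) (Wp t lam)
      (P mu * hsym F r - ∑ lam ∈ psz (mu.size + r), skHL t lam mu • P lam) = 0
    rw [ip_sub_right, mul_comm, W_hP t ht P hP, ip_sum_right, sub_eq_zero]
    have h1 : ∀ nu ∈ psz (mu.size + r), ip (tz t) (Wp t lam) (skHL t nu mu • P nu) =
        if lam = nu then skHL t nu mu else 0 := by
      intro nu _
      rw [ip_smul_right, W_P t ht P hP, mul_ite, mul_one, mul_zero]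
    rw [Finset.sum_congr rfl h1, Finset.sum_ite_eq]
    simp only [mem_psz]
  exact hle (W_span t ht g)

theorem t1_pow (n : ℕ) (hn : 0 < n) : t1 ^ n ≠ 1 := by
  intro h
  rw [t1, ← RatFunc.algebraMap_X, ← map_pow, ← map_one (algebraMap (Polynomial ℚ) (RatFunc ℚ))] at h
  have h2 := congrArg Polynomial.natDegree (RatFunc.algebraMap_injective ℚ h)
  rw [Polynomial.natDegree_X_pow, Polynomial.natDegree_one] at h2
  omega


end FinalPart

/-- Pieri rule for Hall--Littlewood polynomials with a complete
homogeneous symmetric function (Konvalinka--Lauve, Theorem 1): for every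
partition `μ` and `r ≥ 0`, `P_μ(X;t) h_r(X) = ∑_λ sk_{λ/μ}(t) P_λ(X;t)`, the
sum over partitions `λ` with `|λ| = |μ| + r`. -/
theorem pieri_h_hall_littlewood
    (P : Partition → Sym F1) (hP : IsMacdonald (0 : F1) t1 P)
    (mu : Partition) (r : ℕ) :
    P mu * hsym F1 r =
      ∑ᶠ (lam : Partition) (_ : lam.size = mu.size + r), skHL t1 lam mu • P lam := by
  exact pieri_gen t1 t1_pow P hP mu r

end SkewPieriFormalization
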